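/- arXiv:1003.2019 — 7 statements merged into one kernel-verified Lean document; each statement's English description precedes it below -/
import Mathlib

section
/- Let λ ∈ (−π/2, π/2) with cos λ < 1/√2, and let f be a λ-Robertson function. Then f is bounded on the unit disk, i.e., there exists a constant M > 0 such that |f(z)| ≤ M for all z in the unit disk 𝔻. -/
open Metric

lemma deriv_nonpos_left {q : ℝ → ℝ} {q' : ℝ} (h : HasDerivAt q q' 1)
    (hq : ∀ t ∈ Set.Ioo (0:ℝ) 1, q 1 ≤ q t) : q' ≤ 0 := by
  have h1 := (hasDerivAt_iff_tendsto_slope.1 h).mono_left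
    (nhdsWithin_mono 1 (show Set.Iio (1:ℝ) ⊆ {1}ᶜ from fun x hx => ne_of_lt hx))
  refine le_of_tendsto h1 ?_
  have : Set.Ioo (0:ℝ) 1 ∈ nhdsWithin (1:ℝ) (Set.Iio 1) := Ioo_mem_nhdsLT (by norm_num)
  filter_upwards [this] with t ht
  rw [slope_def_field]
  apply div_nonpos_of_nonneg_of_nonpos
  · linarith [hq t ht]
  · linarith [ht.2]

/-- Jack's lemma. -/
lemma jack {w w' : ℂ → ℂ} (hw : ∀ z ∈ ball (0:ℂ) 1, HasDerivAt w (w' z) z) (hw0 : w 0 = 0)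
    {z1 : ℂ} (hz1 : z1 ∈ ball (0:ℂ) 1) (h1 : 1 ≤ ‖w z1‖) :
    ∃ z ∈ ball (0:ℂ) 1, ∃ k : ℝ, 1 ≤ k ∧ ‖w z‖ = 1 ∧ z * w' z = k * w z := by
  have hz1' : ‖z1‖ < 1 := by simpa using hz1
  have hcont : ContinuousOn w (ball 0 1) := fun z hz => (hw z hz).continuousAt.continuousWithinAt
  have hsub : closedBall (0:ℂ) ‖z1‖ ⊆ ball 0 1 := closedBall_subset_ball hz1'
  have hK : IsCompact (closedBall (0:ℂ) ‖z1‖ ∩ (fun z => ‖w z‖) ⁻¹' Set.Ici 1) := by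
    refine (isCompact_closedBall (0:ℂ) ‖z1‖).of_isClosed_subset ?_ Set.inter_subset_left
    exact (hcont.mono hsub).norm.preimage_isClosed_of_isClosed isClosed_closedBall isClosed_Ici
  obtain ⟨z0, hz0, hmin⟩ := hK.exists_isMinOn ⟨z1, by simp, h1⟩ continuous_norm.continuousOn
  have hz0b : z0 ∈ ball (0:ℂ) 1 := hsub hz0.1
  have hz0l : ‖z0‖ ≤ ‖z1‖ := by simpa using hz0.1
  have hz0w : 1 ≤ ‖w z0‖ := hz0.2
  have hz00 : z0 ≠ 0 := by
    rintro rfl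
    rw [hw0] at hz0w; norm_num at hz0w
  have hpos : 0 < ‖z0‖ := norm_pos_iff.2 hz00
  have hlt : ∀ z, ‖z‖ < ‖z0‖ → ‖w z‖ < 1 := by
    intro z hz
    by_contra hc
    have : ‖z0‖ ≤ ‖z‖ := hmin (show z ∈ _ from ⟨by simp; linarith, not_lt.1 hc⟩)
    linarith
  have hle : ∀ z, ‖z‖ = ‖z0‖ → ‖w z‖ ≤ 1 := by
    intro z hz
    have hzb : z ∈ ball (0:ℂ) 1 := by simp; linarith
    have hzc : z ∈ closure (ball (0:ℂ) ‖z0‖) := by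
      rw [closure_ball _ hpos.ne']; simp [hz]
    have hmem := mem_closure_iff_nhdsWithin_neBot.1 hzc
    have ht : Filter.Tendsto (fun z => ‖w z‖) (nhdsWithin z (ball (0:ℂ) ‖z0‖)) (nhds ‖w z‖) :=
      ((hw z hzb).continuousAt.norm.tendsto).mono_left nhdsWithin_le_nhds
    refine le_of_tendsto ht ?_
    filter_upwards [self_mem_nhdsWithin] with y hy
    exact (hlt y (by simpa using hy)).le
  have hone : ‖w z0‖ = 1 := le_antisymm (hle z0 rfl) hz0w
  have hsch : ∀ z, ‖z‖ < ‖z0‖ → ‖w z‖ ≤ 1 / ‖z0‖ * ‖z‖ := by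
    intro z hz
    have := Complex.dist_le_div_mul_dist_of_mapsTo_ball (f := w) (c := 0) (R₁ := ‖z0‖) (R₂ := 1) (z := z)
      (fun z hz => (hw z (ball_subset_ball (by linarith) hz)).differentiableAt.differentiableWithinAt)
      (fun z hz => by simpa [hw0] using (hlt z (by simpa using hz)).le) (by simpa using hz)
    simpa [hw0] using this
  -- radial derivative
  have hrad : 1 ≤ inner ℝ (w z0) (z0 * w' z0) := by
    have hd : HasDerivAt (fun t : ℝ => w (t * z0)) (z0 * w' z0) 1 := by
      have h2 : HasDerivAt (fun t : ℂ => w (t * z0)) (w' z0 * (1 * z0)) ((1:ℝ):ℂ) := by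
        refine HasDerivAt.comp (h₂ := w) (((1:ℝ):ℂ)) ?_ ((hasDerivAt_id _).mul_const z0)
        simpa using hw z0 hz0b
      have := h2.comp_ofReal
      convert this using 1; ring
    have h3 := ((hasDerivAt_id (1:ℝ)).pow 2).sub hd.norm_sq
    have := deriv_nonpos_left h3 (by
      intro t ht
      have hn : ‖(t:ℂ) * z0‖ = t * ‖z0‖ := by
        rw [norm_mul, Complex.norm_real, Real.norm_of_nonneg ht.1.le]
      have h5 := hsch (t * z0) (by rw [hn]; nlinarith [ht.2])
      rw [hn] at h5
      have h6 : 1 / ‖z0‖ * (t * ‖z0‖) = t := by field_simp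
      rw [h6] at h5
      have h7 : ‖w (t * z0)‖ ^ 2 ≤ t ^ 2 := by gcongr
      simp only [Pi.sub_apply, Pi.pow_apply, id_eq, Complex.ofReal_one, one_mul, hone]
      linarith)
    simp only [Complex.ofReal_one, one_mul, id_eq, one_pow, mul_one, Nat.cast_ofNat] at this
    linarith
  have htan : inner ℝ (w z0) (z0 * w' z0 * Complex.I) = 0 := by
    have hd : HasDerivAt (fun t : ℝ => w (z0 * Complex.exp (t * Complex.I)))
        (z0 * w' z0 * Complex.I) 0 := by
      have h2 : HasDerivAt (fun t : ℂ => w (z0 * Complex.exp (t * Complex.I)))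
          (w' z0 * (z0 * (Complex.exp (((0:ℝ):ℂ) * Complex.I) * (1 * Complex.I)))) ((0:ℝ):ℂ) := by
        refine HasDerivAt.comp (h₂ := w) (((0:ℝ):ℂ)) ?_
          ((((hasDerivAt_id _).mul_const Complex.I).cexp).const_mul z0)
        simpa using hw z0 hz0b
      have := h2.comp_ofReal
      convert this using 1; simp; ring
    have hmax : IsLocalMax (fun t : ℝ => ‖w (z0 * Complex.exp (t * Complex.I))‖ ^ 2) 0 := by
      refine Filter.Eventually.of_forall fun t => ?_
      have := hle (z0 * Complex.exp (t * Complex.I)) (by simp [Complex.norm_exp_ofReal_mul_I])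
      simp only [Complex.ofReal_zero, zero_mul, Complex.exp_zero, mul_one, hone]
      gcongr
    have := hmax.hasDerivAt_eq_zero hd.norm_sq
    simpa using this
  refine ⟨z0, hz0b, inner ℝ (w z0) (z0 * w' z0), hrad, hone, ?_⟩
  have hn : (w z0).re * (w z0).re + (w z0).im * (w z0).im = 1 := by
    rw [← Complex.normSq_apply, Complex.normSq_eq_norm_sq, hone]; norm_num
  rw [Complex.inner] at htan ⊢
  generalize z0 * w' z0 = u at *
  generalize w z0 = v at *
  simp at htan
  apply Complex.ext <;> simp
  · linear_combination -u.re * hn + v.im * htan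
  · linear_combination -u.im * hn - v.re * htan

lemma core {L L' : ℂ → ℂ} (hL : ∀ z ∈ ball (0:ℂ) 1, HasDerivAt L (L' z) z) (hL0 : L 0 = 0)
    (hre : ∀ z ∈ ball (0:ℂ) 1, -(1/2) < (z * L' z).re) :
    ∀ z ∈ ball (0:ℂ) 1, ‖1 - Complex.exp (-L z)‖ < 1 := by
  intro z1 hz1
  by_contra hc
  obtain ⟨z, hz, k, hk, hn, he⟩ := jack (w := fun z => 1 - Complex.exp (-L z))
    (w' := fun z => Complex.exp (-L z) * L' z)
    (fun z hz => by
      have := ((hL z hz).neg.cexp).const_sub 1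
      simpa using this) (by simp [hL0]) hz1 (not_lt.1 hc)
  have h := hre z hz
  have hE : Complex.exp (-L z) ≠ 0 := Complex.exp_ne_zero _
  generalize Complex.exp (-L z) = E at *
  have h1 : z * L' z = k * (1 / E - 1) := by
    field_simp
    linear_combination he
  have h2 : (1 - E.re) * (1 - E.re) + E.im * E.im = 1 := by
    have : Complex.normSq (1 - E) = 1 := by rw [Complex.normSq_eq_norm_sq, hn]; norm_num
    rw [Complex.normSq_apply] at this
    simpa using this
  have h3 : (1 / E).re = 1 / 2 := by
    have h4 : Complex.normSq E ≠ 0 := by simpa using hE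
    rw [one_div, Complex.inv_re, div_eq_iff h4, Complex.normSq_apply]
    linarith
  rw [h1, Complex.re_ofReal_mul, Complex.sub_re, h3, Complex.one_re] at h
  linarith

lemma core2 {L L' : ℂ → ℂ} (hL : ∀ z ∈ ball (0:ℂ) 1, HasDerivAt L (L' z) z) (hL0 : L 0 = 0)
    (hre : ∀ z ∈ ball (0:ℂ) 1, -(1/2) < (z * L' z).re) :
    ∀ z ∈ ball (0:ℂ) 1, (L z).re ≤ -Real.log (1 - ‖z‖) ∧ |(L z).im| ≤ Real.pi / 2 := by
  have hw := core hL hL0 hre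
  have hcont : ContinuousOn L (ball 0 1) := fun z hz => (hL z hz).continuousAt.continuousWithinAt
  intro z hz
  have hz' : ‖z‖ < 1 := by simpa using hz
  constructor
  · have h1 : ‖1 - Complex.exp (-L z)‖ ≤ ‖z‖ := by
      refine Complex.norm_le_norm_of_mapsTo_ball (R := 1) (f := fun z => 1 - Complex.exp (-L z))
        ?_ ?_ (by simp [hL0]) hz'
      · intro y hy
        exact (((hL y hy).neg.cexp).const_sub 1).differentiableAt.differentiableWithinAt
      · intro y hy
        simpa using (hw y hy).le
    have h2 : 1 - ‖z‖ ≤ ‖Complex.exp (-L z)‖ := by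
      have := norm_sub_norm_le (1:ℂ) (1 - Complex.exp (-L z))
      simp only [norm_one, sub_sub_cancel] at this
      linarith
    rw [Complex.norm_exp] at h2
    have := Real.log_le_log (by linarith) h2
    rw [Real.log_exp, Complex.neg_re] at this
    linarith
  · by_contra hcon
    push Not at hcon
    have hpre : IsPreconnected (ball (0:ℂ) 1) := (convex_ball 0 1).isPreconnected
    have h0 : (0:ℂ) ∈ ball (0:ℂ) 1 := by simp
    have him : ContinuousOn (fun z => |(L z).im|) (ball 0 1) :=
      (Complex.continuous_im.comp_continuousOn hcont).abs
    obtain ⟨y, hy, hyy⟩ := hpre.intermediate_value h0 hz him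
      (show Real.pi / 2 ∈ _ from ⟨by simp [hL0]; positivity, hcon.le⟩)
    have h1 := hw y hy
    have h2 : (Complex.exp (-L y)).re = 0 := by
      rw [Complex.exp_re, Complex.neg_im, Real.cos_neg, ← Real.cos_abs]
      simp only at hyy
      rw [hyy]; simp
    have h3 := Complex.abs_re_le_norm (1 - Complex.exp (-L y))
    rw [Complex.sub_re, h2] at h3
    norm_num at h3
    linarith

lemma integrate {f : ℂ → ℂ} (hf : DifferentiableOn ℂ f (ball (0 : ℂ) 1)) (hf0 : f 0 = 0)
    {C a : ℝ} (hC : 0 < C) (ha : a < 1)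
    (hb : ∀ z ∈ ball (0:ℂ) 1, ‖deriv f z‖ ≤ C * (1 - ‖z‖) ^ (-a)) :
    ∀ z ∈ ball (0:ℂ) 1, ‖f z‖ ≤ C / (1 - a) := by
  intro z hz
  have hz' : ‖z‖ < 1 := by simpa using hz
  have hmem : ∀ t ∈ Set.Icc (0:ℝ) 1, ‖(t:ℂ) * z‖ = t * ‖z‖ ∧ t * ‖z‖ < 1 := by
    intro t ht
    refine ⟨by rw [norm_mul, Complex.norm_real, Real.norm_of_nonneg ht.1], ?_⟩
    nlinarith [ht.1, ht.2, norm_nonneg z]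
  have hd : ∀ t ∈ Set.Icc (0:ℝ) 1, HasDerivAt (fun t : ℝ => f (t * z)) (deriv f (t * z) * z) t := by
    intro t ht
    have hm : (t:ℂ) * z ∈ ball (0:ℂ) 1 := by
      have := hmem t ht
      rw [mem_ball_zero_iff]; linarith
    have h2 : HasDerivAt (fun t : ℂ => f (t * z)) (deriv f (t * z) * (1 * z)) (t:ℂ) := by
      refine HasDerivAt.comp (h₂ := f) (t:ℂ) ?_ ((hasDerivAt_id _).mul_const z)
      exact (hf.differentiableAt (isOpen_ball.mem_nhds hm)).hasDerivAt
    simpa using h2.comp_ofReal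
  have hB : ∀ t ∈ Set.Icc (0:ℝ) 1, HasDerivAt
      (fun t : ℝ => C / (1 - a) * (1 - (1 - t * ‖z‖) ^ (1 - a)))
      (C * (1 - t * ‖z‖) ^ (-a) * ‖z‖) t := by
    intro t ht
    have h1 : HasDerivAt (fun t : ℝ => 1 - t * ‖z‖) (-(1 * ‖z‖)) t :=
      ((hasDerivAt_id t).mul_const ‖z‖).const_sub 1
    have h2 := h1.rpow_const (p := 1 - a) (Or.inl (by linarith [(hmem t ht).2]))
    have h3 := (h2.const_sub 1).const_mul (C / (1 - a))
    refine h3.congr_deriv ?_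
    have : 1 - a ≠ 0 := by linarith
    rw [show 1 - a - 1 = -a by ring]
    field_simp
  have := image_norm_le_of_norm_deriv_right_le_deriv_boundary' (a := 0) (b := 1)
    (fun t ht => (hd t ht).continuousAt.continuousWithinAt)
    (fun t ht => (hd t ⟨ht.1, ht.2.le⟩).hasDerivWithinAt)
    (B := fun t : ℝ => C / (1 - a) * (1 - (1 - t * ‖z‖) ^ (1 - a)))
    (by simp [hf0])
    (fun t ht => (hB t ht).continuousAt.continuousWithinAt)
    (fun t ht => (hB t ⟨ht.1, ht.2.le⟩).hasDerivWithinAt)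
    (by
      intro t ht
      have hm := hmem t ⟨ht.1, ht.2.le⟩
      rw [norm_mul]
      gcongr
      have := hb (t * z) (by rw [mem_ball_zero_iff]; linarith)
      rwa [hm.1] at this) (show (1:ℝ) ∈ Set.Icc (0:ℝ) 1 by simp)
  simp only [Complex.ofReal_one, one_mul] at this
  refine this.trans ?_
  have h5 : 0 ≤ (1 - ‖z‖) ^ (1 - a) := Real.rpow_nonneg (by linarith) _
  have h6 : 0 < C / (1 - a) := div_pos hC (by linarith)
  nlinarith

/-- A λ-Robertson function with cos λ < 1/√2 is bounded on the unit disk. -/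
theorem robertson_bounded (lam : ℝ) (hlam : lam ∈ Set.Ioo (-(Real.pi / 2)) (Real.pi / 2))
    (hcos : Real.cos lam < 1 / Real.sqrt 2)
    (f : ℂ → ℂ)
    (hf : DifferentiableOn ℂ f (ball (0 : ℂ) 1))
    (hf0 : f 0 = 0) (hf'0 : deriv f 0 = 1)
    (hf' : ∀ z ∈ ball (0 : ℂ) 1, deriv f z ≠ 0)
    (hRob : ∀ z ∈ ball (0 : ℂ) 1,
      0 < (Complex.exp (-(lam : ℂ) * Complex.I) *
        (1 + z * deriv (deriv f) z / deriv f z)).re) :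
    ∃ M > 0, ∀ z ∈ ball (0 : ℂ) 1, ‖f z‖ ≤ M := by
  have hcp : 0 < Real.cos lam := Real.cos_pos_of_mem_Ioo hlam
  have ha : 2 * Real.cos lam ^ 2 < 1 := by
    have h1 : Real.cos lam ^ 2 < (1 / Real.sqrt 2) ^ 2 := by gcongr
    rw [div_pow, Real.sq_sqrt (by norm_num)] at h1
    linarith
  have hF : DifferentiableOn ℂ (deriv f) (ball 0 1) := hf.deriv isOpen_ball
  have hF' : DifferentiableOn ℂ (deriv (deriv f)) (ball 0 1) := hF.deriv isOpen_ball
  set e : ℂ := Complex.exp (lam * Complex.I) with he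
  set c : ℂ := 2 * Real.cos lam * e with hc
  have hc0 : c ≠ 0 := by
    have : (Real.cos lam : ℂ) ≠ 0 := by exact_mod_cast hcp.ne'
    exact mul_ne_zero (mul_ne_zero two_ne_zero this) (Complex.exp_ne_zero _)
  have hG : DifferentiableOn ℂ (fun z => deriv (deriv f) z / (c * deriv f z)) (ball 0 1) :=
    hF'.div (hF.const_mul c) (fun z hz => mul_ne_zero hc0 (hf' z hz))
  obtain ⟨L, hL0, hL⟩ := hG.isExactOn_ball.with_val_at 0 0
  have hre : ∀ z ∈ ball (0:ℂ) 1, -(1/2) < (z * (deriv (deriv f) z / (c * deriv f z))).re := by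
    intro z hz
    have h := hRob z hz
    have hz0 := hf' z hz
    have h1 : Complex.exp (-(lam : ℂ) * Complex.I) * (1 + z * deriv (deriv f) z / deriv f z)
        = Complex.exp (((-lam : ℝ) : ℂ) * Complex.I) +
          ((2 * Real.cos lam : ℝ) : ℂ) * (z * (deriv (deriv f) z / (c * deriv f z))) := by
      have h2 : Complex.exp (-(lam : ℂ) * Complex.I) * e = 1 := by
        rw [he, ← Complex.exp_add]; simp
      have h3 : z * deriv (deriv f) z / deriv f z
          = c * (z * (deriv (deriv f) z / (c * deriv f z))) := by field_simp
      rw [h3]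
      generalize z * (deriv (deriv f) z / (c * deriv f z)) = u
      rw [hc]
      push_cast
      linear_combination (2 * Complex.cos lam * u) * h2
    rw [h1, Complex.add_re, Complex.re_ofReal_mul, Complex.exp_ofReal_mul_I_re, Real.cos_neg] at h
    by_contra hcon
    push Not at hcon
    nlinarith
  have hbd := core2 hL hL0 hre
  have hexp : ∀ z ∈ ball (0:ℂ) 1, deriv f z = Complex.exp (c * L z) := by
    intro z hz
    have hD : ∀ y ∈ ball (0:ℂ) 1,
        HasDerivAt (fun z => deriv f z * Complex.exp (-(c * L z))) 0 y := by
      intro y hy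
      have h1 := (hF.differentiableAt (isOpen_ball.mem_nhds hy)).hasDerivAt.mul
        (((hL y hy).const_mul c).neg.cexp)
      refine h1.congr_deriv ?_
      have := hf' y hy
      field_simp
      ring
    have := isOpen_ball.is_const_of_deriv_eq_zero (convex_ball (0:ℂ) 1).isPreconnected
      (fun y hy => (hD y hy).differentiableAt.differentiableWithinAt)
      (fun y hy => (hD y hy).deriv) hz (show (0:ℂ) ∈ ball (0:ℂ) 1 by simp)
    simp only [hL0, hf'0, mul_zero, neg_zero, Complex.exp_zero, mul_one, Complex.exp_neg] at this
    have h2 := Complex.exp_ne_zero (c * L z)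
    field_simp at this
    exact this
  refine ⟨Real.exp Real.pi / (1 - 2 * Real.cos lam ^ 2),
    div_pos (Real.exp_pos _) (by linarith), ?_⟩
  refine integrate hf hf0 (Real.exp_pos _) ha ?_
  intro z hz
  have hz' : ‖z‖ < 1 := by simpa using hz
  obtain ⟨h1, h2⟩ := hbd z hz
  rw [hexp z hz, Complex.norm_exp, Real.rpow_def_of_pos (by linarith), ← Real.exp_add]
  apply Real.exp_le_exp.2
  have h3 : (c * L z).re = 2 * Real.cos lam ^ 2 * (L z).re
      - 2 * (Real.cos lam * Real.sin lam * (L z).im) := by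
    have h4 : c = ((2 * Real.cos lam : ℝ) : ℂ) * Complex.exp (lam * Complex.I) := by
      rw [hc]; push_cast; ring
    rw [h4, mul_assoc, Complex.re_ofReal_mul, Complex.mul_re, Complex.exp_ofReal_mul_I_re,
      Complex.exp_ofReal_mul_I_im]
    ring
  have h5 : |Real.cos lam * Real.sin lam * (L z).im| ≤ 1 * 1 * (Real.pi / 2) := by
    rw [abs_mul, abs_mul]
    gcongr
    · exact Real.abs_cos_le_one _
    · exact Real.abs_sin_le_one _
  have h6 := neg_le_of_abs_le h5
  have h7 : 2 * Real.cos lam ^ 2 * (L z).re ≤ 2 * Real.cos lam ^ 2 * -Real.log (1 - ‖z‖) := by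
    gcongr
  rw [h3]
  linarith
end

section
/- Let λ ∈ (−π/2, π/2) and let f be analytic on the unit disk 𝔻 with f(0) = 0, f'(0) = 1, f(z) ≠ 0 for z ≠ 0, and Re(e^{−iλ} z f'(z)/f(z)) > 0 for all z ∈ 𝔻 \ {0} (i.e. f is λ-spirallike). Then for every z ∈ 𝔻 with |z| = r one has |f(z)| ≤ Ψ₂(r) := r · exp(sin(2λ) · arcsin(r sin λ)) / (√(1 − r² sin² λ) − r cos λ)^{2 cos² λ}. -/
open Metric

lemma cos_aux (a d : ℝ) (h0 : 0 ≤ d) (h1 : d ≤ Real.pi) :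
    Real.exp (a * d) * (Real.cos d - a * Real.sin d) ≤ 1 := by
  have hd : ∀ x : ℝ, HasDerivAt (fun x => Real.exp (a * x) * (Real.cos x - a * Real.sin x))
      (-(1 + a ^ 2) * Real.exp (a * x) * Real.sin x) x := by
    intro x
    have h1 : HasDerivAt (fun x => Real.exp (a * x)) (Real.exp (a * x) * (a * 1)) x :=
      ((hasDerivAt_id x).const_mul a).exp
    refine (h1.mul ((Real.hasDerivAt_cos x).sub ((Real.hasDerivAt_sin x).const_mul a))).congr_deriv ?_
    simp only [Pi.sub_apply]
    ring
  have hanti : AntitoneOn (fun x => Real.exp (a * x) * (Real.cos x - a * Real.sin x))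
      (Set.Icc 0 Real.pi) := by
    apply antitoneOn_of_deriv_nonpos (convex_Icc _ _)
    · exact fun x _ => (hd x).continuousAt.continuousWithinAt
    · exact fun x _ => (hd x).differentiableAt.differentiableWithinAt
    · intro x hx
      rw [interior_Icc] at hx
      rw [(hd x).deriv]
      have := Real.sin_nonneg_of_nonneg_of_le_pi hx.1.le hx.2.le
      have h2 := Real.exp_pos (a * x)
      have : 0 ≤ (1 + a ^ 2) * Real.exp (a * x) * Real.sin x := by positivity
      linarith
  have := hanti (Set.left_mem_Icc.2 Real.pi_pos.le) ⟨h0, h1⟩ h0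
  simpa using this

lemma cos_aux' (a d : ℝ) (h : |d| ≤ Real.pi) :
    Real.cos d - a * Real.sin d ≤ Real.exp (-(a * d)) := by
  have key : Real.exp (a * d) * (Real.cos d - a * Real.sin d) ≤ 1 := by
    rcases le_total 0 d with h0 | h0
    · exact cos_aux a d h0 ((le_abs_self d).trans h)
    · have := cos_aux (-a) (-d) (by linarith) ((neg_le_abs d).trans h)
      simpa using this
  rw [Real.exp_neg, ← one_div, le_div_iff₀ (Real.exp_pos _)]
  linarith

lemma cosh_aux (b e : ℝ) (h1 : -1 ≤ b) (h2 : b ≤ 1) :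
    Real.exp (b * e) ≤ (1 + b) / 2 * Real.exp e + (1 - b) / 2 * Real.exp (-e) := by
  have := convexOn_exp.2 (Set.mem_univ e) (Set.mem_univ (-e)) (show 0 ≤ (1 + b) / 2 by linarith)
    (show 0 ≤ (1 - b) / 2 by linarith) (by ring)
  simp only [smul_eq_mul] at this
  refine le_trans (le_of_eq ?_) this
  congr 1
  ring

lemma log_aux (lam r : ℝ) (hc : 0 < Real.cos lam) (hr : 0 < r) (hr1 : r < 1) (w : ℂ)
    (hw : ‖w‖ ≤ r) :
    0 < Real.sqrt (1 - r ^ 2 * Real.sin lam ^ 2) - r * Real.cos lam ∧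
    -(Real.cos lam * (Complex.log (1 - w)).re) + Real.sin lam * (Complex.log (1 - w)).im ≤
    -(Real.cos lam * Real.log (Real.sqrt (1 - r ^ 2 * Real.sin lam ^ 2) - r * Real.cos lam))
      + Real.sin lam * Real.arcsin (r * Real.sin lam) := by
  have hsc := Real.sin_sq_add_cos_sq lam
  set c := Real.cos lam with hcdef
  set s := Real.sin lam with hsdef
  have hr2 : r ^ 2 < 1 := by nlinarith
  have hpos : 0 < 1 - r ^ 2 * s ^ 2 := by nlinarith [sq_nonneg s, sq_nonneg c]
  set C := Real.sqrt (1 - r ^ 2 * s ^ 2) with hC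
  have hCpos : 0 < C := Real.sqrt_pos.2 hpos
  have hC2 : C ^ 2 = 1 - r ^ 2 * s ^ 2 := Real.sq_sqrt hpos.le
  have hrc : 0 < r * c := mul_pos hr hc
  have hprod : (C - r * c) * (C + r * c) = 1 - r ^ 2 := by
    have : s ^ 2 = 1 - c ^ 2 := by linarith
    rw [this] at hC2
    linear_combination hC2
  have hρ0 : 0 < C - r * c := by
    by_contra hcon
    push Not at hcon
    nlinarith
  refine ⟨hρ0, ?_⟩
  set t0 := Real.arcsin (r * s) with ht0
  have hs1 : |s| ≤ 1 := Real.abs_sin_le_one lam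
  have hrs : |r * s| < 1 := by
    rw [abs_mul, abs_of_pos hr]; nlinarith [abs_nonneg s]
  rw [abs_lt] at hrs
  have hsin0 : Real.sin t0 = r * s := Real.sin_arcsin hrs.1.le hrs.2.le
  have hcos0 : Real.cos t0 = C := by rw [ht0, Real.cos_arcsin, hC]; ring_nf
  have hw1 : ‖w‖ < 1 := hw.trans_lt hr1
  have hre : 0 < (1 - w).re := by
    have := (Complex.abs_re_le_norm w)
    have := le_abs_self w.re
    simp; linarith
  have hne : (1 - w) ≠ 0 := by
    intro h; rw [h] at hre; simp at hre
  rw [Complex.log_re, Complex.log_im]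
  set θ := Complex.arg (1 - w) with hθ
  set ρ := ‖1 - w‖ with hρ
  have hρpos : 0 < ρ := norm_pos_iff.2 hne
  have hθb : |θ| < Real.pi / 2 := Complex.abs_arg_lt_pi_div_two_iff.2 (Or.inl hre)
  have ht0b : |t0| ≤ Real.pi / 2 := abs_le.2 ⟨Real.neg_pi_div_two_le_arcsin _, Real.arcsin_le_pi_div_two _⟩
  have hcosθ : ρ * Real.cos θ = (1 - w).re := Complex.norm_mul_cos_arg _
  have hquad : ρ ^ 2 + (1 - r ^ 2) ≤ 2 * (ρ * Real.cos θ) := by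
    rw [hcosθ, hρ, ← Complex.normSq_eq_norm_sq, Complex.normSq_apply]
    have h1 : ‖w‖ ^ 2 ≤ r ^ 2 := by gcongr
    rw [← Complex.normSq_eq_norm_sq, Complex.normSq_apply] at h1
    simp
    nlinarith
  set ε := Real.log ρ - Real.log (C - r * c) with hε
  have heε : Real.exp ε = ρ / (C - r * c) := by
    rw [hε, Real.exp_sub, Real.exp_log hρpos, Real.exp_log hρ0]
  have heε' : Real.exp (-ε) = (C - r * c) / ρ := by
    rw [Real.exp_neg, heε, inv_div]
  have i1 := cosh_aux (-(r * c) / C) ε (by rw [le_div_iff₀ hCpos]; linarith)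
    (by rw [div_le_iff₀ hCpos]; linarith)
  have hd : |θ - t0| ≤ Real.pi := by
    have := abs_sub θ t0
    linarith
  have i2 := cos_aux' (r * s / C) (θ - t0) hd
  have i3 : Real.cos (θ - t0) - r * s / C * Real.sin (θ - t0) = Real.cos θ / C := by
    rw [Real.cos_sub, Real.sin_sub, hsin0, hcos0]
    field_simp
    linear_combination Real.cos θ * hC2
  have i4 : (1 + -(r * c) / C) / 2 * Real.exp ε + (1 - -(r * c) / C) / 2 * Real.exp (-ε)
      ≤ Real.cos θ / C := by
    rw [heε, heε']
    have : (1 + -(r * c) / C) / 2 * (ρ / (C - r * c)) + (1 - -(r * c) / C) / 2 * ((C - r * c) / ρ)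
      = (ρ ^ 2 + (1 - r ^ 2)) / (2 * ρ) / C := by
      rw [← hprod]
      have := hρ0.ne'
      field_simp
      ring
    rw [this]
    gcongr
    rw [div_le_iff₀ (by positivity)]
    linarith
  have i5 := (i1.trans i4).trans (i3 ▸ i2)
  rw [Real.exp_le_exp] at i5
  have i6 : r * (-(c * ε) + s * (θ - t0)) ≤ 0 := by
    have : -(r * c) / C * ε + (r * s / C * (θ - t0)) = r * (-(c * ε) + s * (θ - t0)) / C := by
      field_simp
    have h3 : r * (-(c * ε) + s * (θ - t0)) / C ≤ 0 := by linarith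
    by_contra hcon
    push Not at hcon
    exact absurd (div_pos hcon hCpos) (not_lt.2 h3)
  have i7 : -(c * ε) + s * (θ - t0) ≤ 0 := by
    by_contra hcon
    push Not at hcon
    exact absurd (mul_pos hr hcon) (not_lt.2 i6)
  rw [hε] at i7
  linarith

lemma jack_aux (w : ℂ → ℂ) (hw : DifferentiableOn ℂ w (ball 0 1)) (hw0 : w 0 = 0)
    (hw1 : ∀ z ∈ ball (0 : ℂ) 1, w z ≠ 1)
    (hre : ∀ z ∈ ball (0 : ℂ) 1, -(1 / 2 : ℝ) < (z * deriv w z / (1 - w z)).re) :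
    ∀ z ∈ ball (0 : ℂ) 1, ‖w z‖ ≤ ‖z‖ := by
  have hlt : ∀ z ∈ ball (0 : ℂ) 1, ‖w z‖ < 1 := by
    by_contra hcon
    push Not at hcon
    obtain ⟨z1, hz1, hwz1⟩ := hcon
    have hz1' : ‖z1‖ < 1 := by simpa using hz1
    have hsub : closedBall (0 : ℂ) ‖z1‖ ⊆ ball 0 1 := closedBall_subset_ball hz1'
    have hcl : IsClosed (closedBall (0 : ℂ) ‖z1‖ ∩ (fun z => ‖w z‖) ⁻¹' Set.Ici 1) :=
      ((hw.continuousOn.mono hsub).norm).preimage_isClosed_of_isClosed isClosed_closedBall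
        isClosed_Ici
    have hK : IsCompact (closedBall (0 : ℂ) ‖z1‖ ∩ (fun z => ‖w z‖) ⁻¹' Set.Ici 1) :=
      (isCompact_closedBall (0 : ℂ) ‖z1‖).of_isClosed_subset hcl Set.inter_subset_left
    obtain ⟨z0, ⟨hz0, hz0'⟩, hmin⟩ := hK.exists_isMinOn ⟨z1, by simp, hwz1⟩
      continuous_norm.continuousOn
    have hz0b : z0 ∈ ball (0 : ℂ) 1 := hsub hz0
    have hz0le : ‖z0‖ ≤ ‖z1‖ := by simpa using hz0
    have hz0ge : 1 ≤ ‖w z0‖ := hz0'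
    have hz0ne : z0 ≠ 0 := by
      rintro rfl
      rw [hw0, norm_zero] at hz0ge
      linarith
    have hr0 : 0 < ‖z0‖ := norm_pos_iff.2 hz0ne
    have hins : ∀ z, ‖z‖ < ‖z0‖ → ‖w z‖ < 1 := by
      intro z hz
      by_contra hc
      push Not at hc
      have : ‖z0‖ ≤ ‖z‖ := hmin ⟨by simpa using (hz.le.trans hz0le), hc⟩
      linarith
    have hsch : ∀ z, ‖z‖ < ‖z0‖ → ‖w z‖ ≤ 1 / ‖z0‖ * ‖z‖ := by
      intro z hz
      have := Complex.dist_le_div_mul_dist_of_mapsTo_ball (f := w) (c := 0) (R₁ := ‖z0‖) (R₂ := 1)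
        (hw.mono (ball_subset_ball (by simpa using (mem_ball_zero_iff.1 hz0b).le)))
        (fun x hx => by
          rw [hw0]; simpa using (hins x (by simpa using hx)).le) (z := z) (by simpa using hz)
      simpa [hw0] using this
    set B := z0 * deriv w z0 with hB
    set w0 := w z0 with hw0def
    have hone : (1 - w0) ≠ 0 := fun h => hw1 z0 hz0b (by rw [← hw0def]; linear_combination -h)
    -- the curve
    have hwd : HasDerivAt w (deriv w z0) z0 :=
      (hw.differentiableAt (isOpen_ball.mem_nhds hz0b)).hasDerivAt
    have hcurve : ∀ β : ℂ, HasDerivAt (fun s : ℝ => w (z0 * Complex.exp (β * (s : ℂ)))) (B * β) 0 := by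
      intro β
      have h1 : HasDerivAt (fun s : ℂ => z0 * Complex.exp (β * s)) (z0 * β) ((0 : ℝ) : ℂ) := by
        have := ((((hasDerivAt_id ((0 : ℝ) : ℂ)).const_mul β).cexp).const_mul z0)
        simpa using this
      have h2 : HasDerivAt (fun s : ℂ => w (z0 * Complex.exp (β * s))) (deriv w z0 * (z0 * β))
          ((0 : ℝ) : ℂ) := by
        refine HasDerivAt.comp ((0 : ℝ) : ℂ) (h₂ := w) ?_ h1
        simpa using hwd
      exact (h2.comp_ofReal).congr_deriv (by rw [hB]; ring)
    have hbound : ∀ β : ℂ, β.re < 0 → ∀ s : ℝ, 0 < s →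
        ‖w (z0 * Complex.exp (β * (s : ℂ)))‖ ≤ Real.exp (β.re * s) := by
      intro β hβ s hs
      have hn : ‖z0 * Complex.exp (β * (s : ℂ))‖ = ‖z0‖ * Real.exp (β.re * s) := by
        rw [norm_mul, Complex.norm_exp]; simp
      have hl : Real.exp (β.re * s) < 1 := by
        rw [Real.exp_lt_one_iff]; exact mul_neg_of_neg_of_pos hβ hs
      have := hsch (z0 * Complex.exp (β * (s : ℂ))) (by rw [hn]; nlinarith)
      rw [hn] at this
      refine this.trans (le_of_eq ?_)
      field_simp
    have hw0n : ‖w0‖ = 1 := by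
      refine le_antisymm ?_ hz0ge
      have ht : Filter.Tendsto (fun s : ℝ => ‖w (z0 * Complex.exp ((-1) * (s : ℂ)))‖)
          (nhdsWithin 0 (Set.Ioi 0)) (nhds ‖w0‖) := by
        have := (hcurve (-1)).continuousAt.norm.tendsto
        simp only [Complex.ofReal_zero, mul_zero, Complex.exp_zero, mul_one] at this
        exact this.mono_left nhdsWithin_le_nhds
      refine le_of_tendsto ht ?_
      filter_upwards [self_mem_nhdsWithin] with s hs
      refine (hbound (-1) (by simp) s hs).trans ?_
      rw [Real.exp_le_one_iff]
      have : (0 : ℝ) < s := hs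
      simp; linarith
    set β := w0 / (1 - w0) with hβ
    have hnsq : w0.re * w0.re + w0.im * w0.im = 1 := by
      rw [← Complex.normSq_apply, Complex.normSq_eq_norm_sq, hw0n]; norm_num
    have hconj : (starRingEnd ℂ) w0 * w0 = 1 := by
      rw [mul_comm, Complex.mul_conj, Complex.normSq_eq_norm_sq, hw0n]; norm_num
    have hβre : β.re = -(1 / 2) := by
      have hN : Complex.normSq (1 - w0) ≠ 0 := by simpa using hone
      rw [hβ, Complex.div_re, ← add_div, div_eq_iff hN]
      simp only [Complex.normSq_apply, Complex.sub_re, Complex.one_re, Complex.sub_im,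
        Complex.one_im]
      linear_combination -(1 / 2) * hnsq
    have hD : HasDerivAt (fun s : ℝ => ‖w (z0 * Complex.exp (β * (s : ℂ)))‖ ^ 2 - Real.exp (-s))
        (2 * (B / (1 - w0)).re + 1) 0 := by
      have h1 := (hcurve β).norm_sq
      have h2 : HasDerivAt (fun s : ℝ => Real.exp (-s)) (-1) 0 := by
        simpa using (hasDerivAt_neg (0 : ℝ)).exp
      refine (h1.sub h2).congr_deriv ?_
      simp only [Complex.ofReal_zero, mul_zero, Complex.exp_zero, mul_one, Complex.inner]
      rw [sub_neg_eq_add, ← hw0def]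
      congr 3
      rw [hβ]
      linear_combination (B / (1 - w0)) * hconj
    have hle : 2 * (B / (1 - w0)).re + 1 ≤ 0 := by
      refine le_of_tendsto hD.tendsto_slope_zero_right ?_
      filter_upwards [self_mem_nhdsWithin] with s hs
      have hs' : (0 : ℝ) < s := hs
      have hb := hbound β (by rw [hβre]; norm_num) s hs'
      have hb2 : ‖w (z0 * Complex.exp (β * (s : ℂ)))‖ ^ 2 ≤ Real.exp (-s) := by
        calc _ ≤ Real.exp (β.re * s) ^ 2 := by gcongr
          _ = Real.exp (-s) := by
            rw [← Real.exp_nat_mul, hβre]; congr 1; push_cast; ring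
      simp only [zero_add, Complex.ofReal_zero, mul_zero, Complex.exp_zero, mul_one, smul_eq_mul,
        neg_zero, Real.exp_zero, ← hw0def, hw0n]
      apply mul_nonpos_of_nonneg_of_nonpos (by positivity)
      linarith
    have := hre z0 hz0b
    rw [← hw0def, ← hB] at this
    linarith
  intro z hz
  exact Complex.norm_le_norm_of_mapsTo_ball (R := 1) hw
    (fun x hx => by simpa using (hlt x hx).le) hw0 (by simpa using hz)

/-- Growth upper bound for λ-spirallike functions:
`|f(z)| ≤ Ψ₂(r) = r·exp(sin(2λ)·arcsin(r sin λ)) / (√(1 − r² sin² λ) − r cos λ)^(2 cos² λ)`. -/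
theorem spirallike_growth_upper (lam : ℝ)
    (hlam : lam ∈ Set.Ioo (-(Real.pi / 2)) (Real.pi / 2))
    (f : ℂ → ℂ)
    (hf : DifferentiableOn ℂ f (ball (0 : ℂ) 1))
    (hf0 : f 0 = 0) (hf'0 : deriv f 0 = 1)
    (hfne : ∀ z ∈ ball (0 : ℂ) 1, z ≠ 0 → f z ≠ 0)
    (hsp : ∀ z ∈ ball (0 : ℂ) 1, z ≠ 0 →
      0 < (Complex.exp (-(lam : ℂ) * Complex.I) * (z * deriv f z / f z)).re) :
    ∀ z ∈ ball (0 : ℂ) 1,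
      ‖f z‖ ≤
        ‖z‖ *
          Real.exp (Real.sin (2 * lam) * Real.arcsin (‖z‖ * Real.sin lam)) /
          (Real.sqrt (1 - ‖z‖ ^ 2 * Real.sin lam ^ 2) -
            ‖z‖ * Real.cos lam) ^ (2 * Real.cos lam ^ 2) := by
  have hc : 0 < Real.cos lam := Real.cos_pos_of_mem_Ioo hlam
  have h0mem : (0 : ℂ) ∈ ball (0 : ℂ) 1 := by simp
  have hpre : IsPreconnected (ball (0 : ℂ) 1) := (convex_ball (0 : ℂ) 1).isPreconnected
  set F := dslope f 0 with hF
  have hFd : DifferentiableOn ℂ F (ball 0 1) :=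
    (Complex.differentiableOn_dslope (isOpen_ball.mem_nhds h0mem)).2 hf
  have hF0 : F 0 = 1 := by rw [hF, dslope_same, hf'0]
  have hfF : ∀ z, f z = z * F z := by
    intro z
    have := sub_smul_dslope f 0 z
    simp only [sub_zero, hf0, smul_eq_mul] at this
    exact this.symm
  have hFne : ∀ z ∈ ball (0 : ℂ) 1, F z ≠ 0 := by
    intro z hz
    rcases eq_or_ne z 0 with rfl | hz0
    · rw [hF0]; exact one_ne_zero
    · intro h
      exact hfne z hz hz0 (by rw [hfF, h, mul_zero])
  have hFda : ∀ z ∈ ball (0 : ℂ) 1, HasDerivAt F (deriv F z) z := fun z hz =>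
    (hFd.differentiableAt (isOpen_ball.mem_nhds hz)).hasDerivAt
  have hfder : ∀ z ∈ ball (0 : ℂ) 1, deriv f z = F z + z * deriv F z := by
    intro z hz
    have h1 : HasDerivAt (fun z => z * F z) (1 * F z + z * deriv F z) z :=
      (hasDerivAt_id z).mul (hFda z hz)
    have h2 : f = fun z => z * F z := funext hfF
    rw [h2, h1.deriv, one_mul]
  set k : ℂ := 2 * Complex.exp (lam * Complex.I) * (Real.cos lam : ℂ) with hk
  have hcC : (Real.cos lam : ℂ) ≠ 0 := by exact_mod_cast hc.ne'
  have hkne : k ≠ 0 := mul_ne_zero (mul_ne_zero two_ne_zero (Complex.exp_ne_zero _)) hcC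
  have hkinv : k⁻¹ = Complex.exp (-(lam : ℂ) * Complex.I) * ((1 / (2 * Real.cos lam) : ℝ) : ℂ) := by
    rw [hk, neg_mul, Complex.exp_neg]
    push_cast
    have := Complex.exp_ne_zero (lam * Complex.I)
    push_cast at hcC
    field_simp
  obtain ⟨g, hg0, hg⟩ := (DifferentiableOn.isExactOn_ball (c := 0) (r := 1)
    (f := fun z => k⁻¹ * (deriv F z / F z))
    (((hFd.deriv isOpen_ball).div hFd hFne).const_mul _)).with_val_at 0 0
  -- `F = exp (k g)`
  have hFexp : ∀ z ∈ ball (0 : ℂ) 1, F z = Complex.exp (k * g z) := by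
    intro z hz
    have hd : ∀ x ∈ ball (0 : ℂ) 1, HasDerivAt (fun x => F x * Complex.exp (-(k * g x))) 0 x := by
      intro x hx
      have h1 := (hFda x hx).mul (((hg x hx).const_mul k).neg.cexp)
      refine h1.congr_deriv ?_
      have := hFne x hx
      simp only [Pi.neg_apply]
      field_simp
      ring
    have := isOpen_ball.is_const_of_deriv_eq_zero hpre
      (fun x hx => (hd x hx).differentiableAt.differentiableWithinAt)
      (fun x hx => (hd x hx).deriv) hz h0mem
    simp only [hF0, hg0, mul_zero, neg_zero, Complex.exp_zero, mul_one] at this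
    rw [Complex.exp_neg, mul_inv_eq_one₀ (Complex.exp_ne_zero _)] at this
    exact this
  set w : ℂ → ℂ := fun z => 1 - Complex.exp (-(g z)) with hw
  have hwd : ∀ z ∈ ball (0 : ℂ) 1,
      HasDerivAt w (Complex.exp (-(g z)) * (k⁻¹ * (deriv F z / F z))) z := by
    intro z hz
    refine (((hg z hz).neg.cexp).const_sub 1).congr_deriv ?_
    simp only [Pi.neg_apply]
    ring
  have hwle : ∀ z ∈ ball (0 : ℂ) 1, ‖w z‖ ≤ ‖z‖ := by
    apply jack_aux
    · exact fun z hz => (hwd z hz).differentiableAt.differentiableWithinAt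
    · simp [hw, hg0]
    · intro z hz h
      have : Complex.exp (-(g z)) = 0 := by
        simp only [hw] at h
        linear_combination -h
      exact Complex.exp_ne_zero _ this
    · intro z hz
      rw [(hwd z hz).deriv]
      rcases eq_or_ne z 0 with rfl | hz0
      · simp
      · have e1 : z * (Complex.exp (-(g z)) * (k⁻¹ * (deriv F z / F z))) / (1 - w z)
            = ((1 / (2 * Real.cos lam) : ℝ) : ℂ) *
              (Complex.exp (-(lam : ℂ) * Complex.I) * (z * deriv f z / f z)
                - Complex.exp (-(lam : ℂ) * Complex.I)) := by
          have hx : 1 - w z = Complex.exp (-(g z)) := by simp [hw]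
          have hy := Complex.exp_ne_zero (-(g z))
          have hFz := hFne z hz
          rw [hx, hkinv, hfder z hz, hfF]
          generalize ((1 / (2 * Real.cos lam) : ℝ) : ℂ) = q
          field_simp
          ring
        rw [e1, Complex.re_ofReal_mul, Complex.sub_re]
        have e2 : (Complex.exp (-(lam : ℂ) * Complex.I)).re = Real.cos lam := by
          rw [← Complex.ofReal_neg, Complex.exp_ofReal_mul_I_re, Real.cos_neg]
        rw [e2]
        have := hsp z hz hz0
        set Q := (Complex.exp (-(lam : ℂ) * Complex.I) * (z * deriv f z / f z)).re
        have e3 : 1 / (2 * Real.cos lam) * (Q - Real.cos lam)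
          = 1 / (2 * Real.cos lam) * Q - 1 / 2 := by field_simp
        rw [e3]
        have : 0 < 1 / (2 * Real.cos lam) * Q := by positivity
        linarith
  -- `g = - log (1 - w)`
  have hglog : ∀ z ∈ ball (0 : ℂ) 1, Complex.log (1 - w z) = -(g z) := by
    have hslit : ∀ x ∈ ball (0 : ℂ) 1, Complex.exp (-(g x)) ∈ Complex.slitPlane := by
      intro x hx
      left
      have h1 : ‖w x‖ < 1 := (hwle x hx).trans_lt (by simpa using hx)
      have h2 : (w x).re < 1 := ((le_abs_self _).trans (Complex.abs_re_le_norm _)).trans_lt h1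
      simp only [hw, Complex.sub_re, Complex.one_re] at h2
      linarith
    have hd : ∀ x ∈ ball (0 : ℂ) 1,
        HasDerivAt (fun x => Complex.log (Complex.exp (-(g x))) + g x) 0 x := by
      intro x hx
      have h1 := (((hg x hx).neg.cexp).clog (hslit x hx)).add (hg x hx)
      refine h1.congr_deriv ?_
      have := Complex.exp_ne_zero (-(g x))
      simp only [Pi.neg_apply]
      field_simp
      ring
    intro z hz
    have := isOpen_ball.is_const_of_deriv_eq_zero hpre
      (fun x hx => (hd x hx).differentiableAt.differentiableWithinAt)
      (fun x hx => (hd x hx).deriv) hz h0mem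
    simp only [hg0, neg_zero, Complex.exp_zero, Complex.log_one, add_zero] at this
    have hx : 1 - w z = Complex.exp (-(g z)) := by simp [hw]
    rw [hx]
    linear_combination this
  intro z hz
  rcases eq_or_ne z 0 with rfl | hz0
  · simp [hf0]
  have hr : 0 < ‖z‖ := norm_pos_iff.2 hz0
  have hr1 : ‖z‖ < 1 := by simpa using hz
  obtain ⟨hpos, hmain⟩ := log_aux lam ‖z‖ hc hr hr1 (w z) (hwle z hz)
  rw [hglog z hz] at hmain
  rw [hfF, norm_mul, hFexp z hz, Complex.norm_exp, mul_div_assoc]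
  refine mul_le_mul_of_nonneg_left ?_ hr.le
  rw [Real.rpow_def_of_pos hpos, ← Real.exp_sub, Real.exp_le_exp, Real.sin_two_mul]
  have hkre : k.re = 2 * Real.cos lam * Real.cos lam := by
    rw [hk, Complex.re_mul_ofReal]
    simp [Complex.exp_ofReal_mul_I_re]
  have hkim : k.im = 2 * Real.sin lam * Real.cos lam := by
    rw [hk, Complex.im_mul_ofReal]
    simp [Complex.exp_ofReal_mul_I_im]
  rw [Complex.mul_re, hkre, hkim]
  simp only [Complex.neg_re, Complex.neg_im] at hmain
  have := mul_le_mul_of_nonneg_left hmain (show 0 ≤ 2 * Real.cos lam by positivity)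
  linarith
end

section
/- Let λ ∈ (−π/2, π/2) and let f be a λ-Robertson function. Then for every z ∈ 𝔻 with |z| = r > 0 one has |f'(z)| ≤ exp(sin(2λ) · arcsin(r sin λ)) / (√(1 − r² sin² λ) − r cos λ)^{2 cos² λ}. -/
open Metric

lemma log_cos_tangent {x y : ℝ} (hx : x ∈ Set.Ioo (-(Real.pi / 2)) (Real.pi / 2))
    (hy : y ∈ Set.Ioo (-(Real.pi / 2)) (Real.pi / 2)) :
    Real.log (Real.cos x) ≤ Real.log (Real.cos y) - Real.tan y * (x - y) := by
  have hd : ∀ t ∈ Set.Ioo (-(Real.pi / 2)) (Real.pi / 2),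
      HasDerivAt (fun t => Real.log (Real.cos t)) (-Real.tan t) t := by
    intro t ht
    have hc := Real.cos_pos_of_mem_Ioo ht
    have := (Real.hasDerivAt_cos t).log hc.ne'
    convert this using 1
    rw [Real.tan_eq_sin_div_cos]; ring
  rcases lt_trichotomy x y with h | h | h
  · obtain ⟨c, hc, hc'⟩ := exists_hasDerivAt_eq_slope (fun t => Real.log (Real.cos t))
      (fun t => -Real.tan t) h
      (fun t ht => (hd t ⟨lt_of_lt_of_le hx.1 ht.1, lt_of_le_of_lt ht.2 hy.2⟩).continuousAt.continuousWithinAt)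
      (fun t ht => hd t ⟨lt_trans hx.1 ht.1, lt_trans ht.2 hy.2⟩)
    have h1 : Real.tan c < Real.tan y :=
      Real.tan_lt_tan_of_lt_of_lt_pi_div_two (lt_trans hx.1 hc.1) hy.2 hc.2
    rw [eq_div_iff (by linarith)] at hc'
    nlinarith
  · subst h; simp
  · obtain ⟨c, hc, hc'⟩ := exists_hasDerivAt_eq_slope (fun t => Real.log (Real.cos t))
      (fun t => -Real.tan t) h
      (fun t ht => (hd t ⟨lt_of_lt_of_le hy.1 ht.1, lt_of_le_of_lt ht.2 hx.2⟩).continuousAt.continuousWithinAt)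
      (fun t ht => hd t ⟨lt_trans hy.1 ht.1, lt_trans ht.2 hx.2⟩)
    have h1 : Real.tan y < Real.tan c :=
      Real.tan_lt_tan_of_lt_of_lt_pi_div_two hy.1 (lt_trans hc.2 hx.2) hc.1
    rw [eq_div_iff (by linarith)] at hc'
    nlinarith

lemma extremal_bound (lam r : ℝ) (hlam : lam ∈ Set.Ioo (-(Real.pi / 2)) (Real.pi / 2))
    (hr0 : 0 < r) (hr1 : r < 1) (w : ℂ) (hw : ‖w‖ ≤ r) :
    0 < Real.sqrt (1 - r ^ 2 * Real.sin lam ^ 2) - r * Real.cos lam ∧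
    Real.sin lam * (1 - w).arg - Real.cos lam * Real.log ‖1 - w‖ ≤
      Real.sin lam * Real.arcsin (r * Real.sin lam) - Real.cos lam *
        Real.log (Real.sqrt (1 - r ^ 2 * Real.sin lam ^ 2) - r * Real.cos lam) := by
  have hc := Real.cos_pos_of_mem_Ioo hlam
  have hsc := Real.sin_sq_add_cos_sq lam
  set s := Real.sin lam
  set c := Real.cos lam
  have hS2 : 0 < 1 - r ^ 2 * s ^ 2 := by nlinarith [sq_nonneg s, sq_nonneg c]
  set S := Real.sqrt (1 - r ^ 2 * s ^ 2) with hS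
  have hSpos : 0 < S := Real.sqrt_pos.2 hS2
  have hSsq : S ^ 2 = 1 - r ^ 2 * s ^ 2 := Real.sq_sqrt hS2.le
  have hprod : (S - r * c) * (S + r * c) = 1 - r ^ 2 := by nlinarith
  have hrc : 0 < r * c := by positivity
  have hrho0 : 0 < S - r * c := by
    by_contra h
    nlinarith
  refine ⟨hrho0, ?_⟩
  set φ0 := Real.arcsin (r * s) with hφ0
  have hrs : (r * s) ^ 2 < 1 := by nlinarith
  have hrs' := abs_lt.1 ((sq_lt_one_iff_abs_lt_one _).1 hrs)
  have hcos0 : Real.cos φ0 = S := by rw [hφ0, Real.cos_arcsin, mul_pow]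
  have htan0 : Real.tan φ0 = r * s / S := by
    rw [Real.tan_eq_sin_div_cos, hcos0, hφ0, Real.sin_arcsin hrs'.1.le hrs'.2.le]
  have hφ0m : φ0 ∈ Set.Ioo (-(Real.pi / 2)) (Real.pi / 2) :=
    ⟨Real.neg_pi_div_two_lt_arcsin.2 hrs'.1, Real.arcsin_lt_pi_div_two.2 hrs'.2⟩
  have hre : 0 < (1 - w).re := by
    have := (Complex.re_le_norm w)
    simp; linarith
  have hne : (1 - w) ≠ 0 := by
    intro h; rw [h] at hre; simp at hre
  have hρ : 0 < ‖1 - w‖ := norm_pos_iff.2 hne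
  have hφm : (1 - w).arg ∈ Set.Ioo (-(Real.pi / 2)) (Real.pi / 2) := by
    have := Complex.abs_arg_lt_pi_div_two_iff.2 (Or.inl hre)
    exact abs_lt.1 this
  have hcosφ : ‖1 - w‖ * Real.cos (1 - w).arg = (1 - w).re := by
    rw [Complex.cos_arg hne]; field_simp
  have hcosφp := Real.cos_pos_of_mem_Ioo hφm
  have htan := log_cos_tangent hφm hφ0m
  rw [hcos0, htan0] at htan
  set φ := (1 - w).arg
  set ρ := ‖1 - w‖ with hρdef
  set ρ0 := S - r * c with hρ0
  have hw2 : w.re ^ 2 + w.im ^ 2 ≤ r ^ 2 := by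
    have : ‖w‖ ^ 2 ≤ r ^ 2 := by gcongr
    rw [← Complex.normSq_eq_norm_sq, Complex.normSq_apply] at this
    nlinarith
  have hρ2 : ρ ^ 2 = (1 - w.re) ^ 2 + w.im ^ 2 := by
    rw [hρdef, ← Complex.normSq_eq_norm_sq, Complex.normSq_apply]; simp; ring
  have hmain : ρ ^ 2 + (1 - r ^ 2) ≤ 2 * (ρ * Real.cos φ) := by
    rw [hcosφ]; simp; nlinarith
  set d := Real.log ρ - Real.log ρ0 with hd
  have hed : Real.exp d = ρ / ρ0 := by rw [hd, Real.exp_sub, Real.exp_log hρ, Real.exp_log hrho0]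
  have hed' : Real.exp (-d) = ρ0 / ρ := by rw [Real.exp_neg, hed, inv_div]
  have hconv := convexOn_exp.2 (Set.mem_univ d) (Set.mem_univ (-d))
    (show 0 ≤ ρ0 / (2 * S) by positivity) (show 0 ≤ (S + r * c) / (2 * S) by positivity)
    (by rw [hρ0]; field_simp; ring)
  simp only [smul_eq_mul, hed, hed'] at hconv
  have h1 : ρ0 / (2 * S) * d + (S + r * c) / (2 * S) * -d = -(r * c / S) * d := by
    rw [hρ0]; field_simp; ring
  rw [h1] at hconv
  have h2 : ρ0 / (2 * S) * (ρ / ρ0) + (S + r * c) / (2 * S) * (ρ0 / ρ)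
      = (ρ ^ 2 + (1 - r ^ 2)) / (2 * S * ρ) := by
    rw [← hprod]; field_simp
  rw [h2] at hconv
  have h3 : Real.exp (-(r * c / S) * d) * S ≤ Real.cos φ := by
    have : (ρ ^ 2 + (1 - r ^ 2)) / (2 * S * ρ) ≤ Real.cos φ / S := by
      rw [div_le_div_iff₀ (by positivity) hSpos]; nlinarith
    exact (le_div_iff₀ hSpos).1 (hconv.trans this)
  have h4 := Real.log_le_log (by positivity) h3
  rw [Real.log_mul (Real.exp_pos _).ne' hSpos.ne', Real.log_exp] at h4
  have h5 : (r / S) * (s * (φ - φ0)) ≤ (r / S) * (c * d) := by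
    have e1 : (r / S) * (s * (φ - φ0)) = r * s / S * (φ - φ0) := by ring
    have e2 : (r / S) * (c * d) = r * c / S * d := by ring
    rw [e1, e2]; linarith
  have h6 := le_of_mul_le_mul_left h5 (by positivity)
  rw [hd] at h6
  linarith

lemma deriv_nonpos_of_right {k : ℝ → ℝ} {k' : ℝ} (hk : HasDerivAt k k' 0) (h0 : k 0 = 0)
    (h : ∀ s, 0 < s → k s ≤ 0) : k' ≤ 0 := by
  have h1 := (hk.hasDerivWithinAt (s := Set.Ioi 0))
  rw [hasDerivWithinAt_iff_tendsto_slope' (by simp)] at h1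
  refine le_of_tendsto h1 ?_
  filter_upwards [self_mem_nhdsWithin] with s hs
  rw [slope_def_field, h0]
  exact div_nonpos_of_nonpos_of_nonneg (by simpa using h s hs) (by simpa using le_of_lt hs)

lemma jack_dir {φ : ℂ → ℂ} {z0 φ' v : ℂ} (hφ : HasDerivAt φ φ' z0) (hv : v.re ≤ 0)
    (h1 : ‖φ z0‖ = 1) (hb : ∀ z, ‖z‖ ≤ ‖z0‖ → ‖φ z‖ * ‖z0‖ ≤ ‖z‖) (hz0 : z0 ≠ 0) :
    (z0 * φ' * (starRingEnd ℂ) (φ z0) * v).re ≤ v.re := by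
  have hγ : HasDerivAt (fun s : ℝ => z0 * Complex.exp (s * v)) (z0 * v) 0 := by
    have h : HasDerivAt (fun s : ℂ => z0 * Complex.exp (s * v)) (z0 * v) ((0 : ℝ) : ℂ) := by
      have := (((hasDerivAt_id ((0 : ℝ) : ℂ)).mul_const v).cexp).const_mul z0
      simpa using this
    exact h.comp_ofReal
  have hφγ : HasDerivAt (fun s : ℝ => φ (z0 * Complex.exp (s * v))) (φ' * (z0 * v)) 0 := by
    have h' : HasDerivAt φ φ' ((fun s : ℝ => z0 * Complex.exp (s * v)) 0) := by simpa using hφ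
    exact h'.comp (0 : ℝ) hγ
  have hn := hφγ.norm_sq
  have he : HasDerivAt (fun s : ℝ => Real.exp (s * (2 * v.re))) (2 * v.re) 0 := by
    simpa using ((hasDerivAt_id (0 : ℝ)).mul_const (2 * v.re)).exp
  have key := deriv_nonpos_of_right (hn.sub he) (by simp [h1]) (by
    intro s hs
    have hnorm : ‖z0 * Complex.exp (s * v)‖ = ‖z0‖ * Real.exp (s * v.re) := by
      rw [norm_mul, Complex.norm_exp]; simp
    have hle : Real.exp (s * v.re) ≤ 1 := by
      rw [Real.exp_le_one_iff]; exact mul_nonpos_of_nonneg_of_nonpos hs.le hv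
    have hz : 0 < ‖z0‖ := norm_pos_iff.2 hz0
    have h3 := hb (z0 * Complex.exp (s * v)) (by rw [hnorm]; nlinarith)
    rw [hnorm, mul_comm] at h3
    have h4 := le_of_mul_le_mul_left h3 hz
    have h5 : Real.exp (s * (2 * v.re)) = Real.exp (s * v.re) ^ 2 := by
      rw [← Real.exp_nat_mul]; congr 1; push_cast; ring
    simp only [Pi.sub_apply]
    rw [h5, sub_nonpos]
    gcongr)
  have e : inner ℝ (φ (z0 * Complex.exp ((0 : ℝ) * v))) (φ' * (z0 * v)) =
      (z0 * φ' * (starRingEnd ℂ) (φ z0) * v).re := by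
    rw [Complex.inner]; simp; ring
  rw [e] at key
  linarith

lemma marx {F F' : ℂ → ℂ} (hF : ∀ z ∈ ball (0 : ℂ) 1, HasDerivAt F (F' z) z) (h0 : F 0 = 0)
    (hre : ∀ z ∈ ball (0 : ℂ) 1, -(1 / 2) < (z * F' z).re) :
    ∀ z ∈ ball (0 : ℂ) 1, ‖1 - Complex.exp (-F z)‖ < 1 := by
  intro z1 hz1
  by_contra hcon
  push Not at hcon
  set φ : ℂ → ℂ := fun z => 1 - Complex.exp (-F z) with hφdef
  have hφ : ∀ z ∈ ball (0 : ℂ) 1, HasDerivAt φ (F' z * Complex.exp (-F z)) z := by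
    intro z hz
    have : HasDerivAt φ (-(Complex.exp (-F z) * -F' z)) z := ((hF z hz).neg.cexp).const_sub 1
    convert this using 1; ring
  have hsub : closedBall (0 : ℂ) ‖z1‖ ⊆ ball 0 1 := closedBall_subset_ball (by simpa using hz1)
  have hcont : ContinuousOn φ (closedBall (0 : ℂ) ‖z1‖) :=
    fun z hz => (hφ z (hsub hz)).continuousAt.continuousWithinAt
  have hK : IsCompact (closedBall (0 : ℂ) ‖z1‖ ∩ {z | 1 ≤ ‖φ z‖}) := by
    have : IsClosed (closedBall (0 : ℂ) ‖z1‖ ∩ (fun z => ‖φ z‖) ⁻¹' Set.Ici 1) :=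
      hcont.norm.preimage_isClosed_of_isClosed isClosed_closedBall isClosed_Ici
    exact (isCompact_closedBall (0 : ℂ) ‖z1‖).of_isClosed_subset this Set.inter_subset_left
  obtain ⟨z0, ⟨hz0m, hz0⟩, hmin⟩ := hK.exists_isMinOn ⟨z1, by simp, hcon⟩ continuous_norm.continuousOn
  have hz0b : z0 ∈ ball (0 : ℂ) 1 := hsub hz0m
  have hφ0 : φ 0 = 0 := by simp [hφdef, h0]
  have hz0ne : z0 ≠ 0 := by
    rintro rfl
    simp only [Set.mem_ofPred_eq, hφ0, norm_zero] at hz0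
    linarith
  have hz0p : 0 < ‖z0‖ := norm_pos_iff.2 hz0ne
  have hz0le : ‖z0‖ ≤ ‖z1‖ := by simpa using hz0m
  have hlt : ∀ z, ‖z‖ < ‖z0‖ → ‖φ z‖ < 1 := by
    intro z hz
    by_contra h
    push Not at h
    have := hmin (show z ∈ _ from ⟨by simpa using (hz.trans_le hz0le).le, h⟩)
    simp only [Set.mem_ofPred_eq] at this
    linarith
  have hsch : ∀ z ∈ ball (0 : ℂ) ‖z0‖, ‖φ z‖ * ‖z0‖ ≤ ‖z‖ := by
    intro z hz
    have hd : DifferentiableOn ℂ φ (ball 0 ‖z0‖) := fun y hy =>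
      (hφ y (hsub (by simp at hy ⊢; linarith))).differentiableAt.differentiableWithinAt
    have := Complex.dist_le_div_mul_dist_of_mapsTo_ball (R₂ := 1) hd
      (fun y hy => by rw [hφ0]; simpa using (hlt y (by simpa using hy)).le) hz
    rw [hφ0, dist_zero_right, dist_zero_right, div_mul_eq_mul_div, one_mul, le_div_iff₀ hz0p] at this
    exact this
  have hb : ∀ z, ‖z‖ ≤ ‖z0‖ → ‖φ z‖ * ‖z0‖ ≤ ‖z‖ := by
    intro z hz
    have hcl : z ∈ closure (ball (0 : ℂ) ‖z0‖) := by
      rw [closure_ball _ hz0p.ne']; simpa using hz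
    refine le_on_closure hsch ?_ continuous_norm.continuousOn hcl
    rw [closure_ball _ hz0p.ne']
    exact (hcont.norm.mono (closedBall_subset_closedBall hz0le)).mul continuousOn_const
  have h1 : ‖φ z0‖ = 1 := by
    refine le_antisymm ?_ hz0
    have := hb z0 le_rfl
    nlinarith
  have hD := hφ z0 hz0b
  have a1 := jack_dir (v := -1) hD (by simp) h1 hb hz0ne
  have a2 := jack_dir (v := Complex.I) hD (by simp) h1 hb hz0ne
  have a3 := jack_dir (v := -Complex.I) hD (by simp) h1 hb hz0ne
  have hexp : Complex.exp (-F z0) = 1 - φ z0 := by simp [hφdef]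
  have hne : 1 - φ z0 ≠ 0 := by rw [← hexp]; exact Complex.exp_ne_zero _
  have hp := hre z0 hz0b
  have hns : (φ z0).re * (φ z0).re + (φ z0).im * (φ z0).im = 1 := by
    rw [← Complex.normSq_apply, Complex.normSq_eq_norm_sq, h1]; norm_num
  have hA : z0 * (F' z0 * Complex.exp (-F z0)) * (starRingEnd ℂ) (φ z0)
      = (z0 * F' z0) * ((starRingEnd ℂ) (φ z0) - 1) := by
    have : φ z0 * (starRingEnd ℂ) (φ z0) = 1 := by
      rw [Complex.mul_conj, Complex.normSq_apply, hns]; simp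
    rw [hexp]
    linear_combination (-(z0 * F' z0)) * this
  rw [hA] at a1 a2 a3
  have hx : (φ z0).re < 1 := by
    have hle : (φ z0).re ≤ 1 := h1 ▸ Complex.re_le_norm _
    refine lt_of_le_of_ne hle fun h => hne ?_
    have him : (φ z0).im = 0 := by
      rw [h] at hns; nlinarith
    apply Complex.ext <;> simp [h, him]
  generalize φ z0 = u at *
  generalize z0 * F' z0 = P at *
  simp only [Complex.mul_re, Complex.mul_im, Complex.sub_re, Complex.sub_im, Complex.conj_re,
    Complex.conj_im, Complex.one_re, Complex.one_im, Complex.neg_re, Complex.neg_im,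
    Complex.I_re, Complex.I_im] at a1 a2 a3
  have b1 : 1 ≤ P.re * (u.re - 1) + P.im * u.im := by linarith
  have b2 : P.im * (u.re - 1) - P.re * u.im = 0 := by linarith
  have b3 : (P.re * (u.re - 1) + P.im * u.im) * (u.re - 1) = P.re * (2 - 2 * u.re) := by
    linear_combination u.im * b2 + P.re * hns
  nlinarith

open Metric

/-- Derivative bound for λ-Robertson functions:
`|f'(z)| ≤ exp(sin(2λ)·arcsin(r sin λ)) / (√(1 − r² sin² λ) − r cos λ)^(2 cos² λ)` for `|z| = r > 0`. -/
theorem robertson_deriv_bound (lam : ℝ)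
    (hlam : lam ∈ Set.Ioo (-(Real.pi / 2)) (Real.pi / 2))
    (f : ℂ → ℂ)
    (hf : DifferentiableOn ℂ f (ball (0 : ℂ) 1))
    (hf0 : f 0 = 0) (hf'0 : deriv f 0 = 1)
    (hf' : ∀ z ∈ ball (0 : ℂ) 1, deriv f z ≠ 0)
    (hRob : ∀ z ∈ ball (0 : ℂ) 1,
      0 < (Complex.exp (-(lam : ℂ) * Complex.I) *
        (1 + z * deriv (deriv f) z / deriv f z)).re) :
    ∀ z ∈ ball (0 : ℂ) 1, z ≠ 0 →
      ‖deriv f z‖ ≤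
        Real.exp (Real.sin (2 * lam) * Real.arcsin (‖z‖ * Real.sin lam)) /
          (Real.sqrt (1 - ‖z‖ ^ 2 * Real.sin lam ^ 2) -
            ‖z‖ * Real.cos lam) ^ (2 * Real.cos lam ^ 2) := by
  have hc := Real.cos_pos_of_mem_Ioo hlam
  set g := deriv f with hg
  have hgd : DifferentiableOn ℂ g (ball 0 1) := hf.deriv isOpen_ball
  have hg'd : DifferentiableOn ℂ (deriv g) (ball 0 1) := hgd.deriv isOpen_ball
  have hgD : ∀ z ∈ ball (0 : ℂ) 1, HasDerivAt g (deriv g z) z := fun z hz =>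
    (hgd.differentiableAt (isOpen_ball.mem_nhds hz)).hasDerivAt
  set c : ℂ := 2 * (Real.cos lam : ℂ) * Complex.exp (lam * Complex.I) with hcdef
  have hcne : c ≠ 0 := by
    have : (Real.cos lam : ℂ) ≠ 0 := by exact_mod_cast hc.ne'
    simp only [hcdef]
    exact mul_ne_zero (mul_ne_zero two_ne_zero this) (Complex.exp_ne_zero _)
  have hq : DifferentiableOn ℂ (fun z => deriv g z / (c * g z)) (ball 0 1) :=
    hg'd.div (hgd.const_mul c) (fun z hz => mul_ne_zero hcne (hf' z hz))
  obtain ⟨F, hF0, hF⟩ := hq.isExactOn_ball.with_val_at 0 0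
  have hexpI : Complex.exp (-(lam : ℂ) * Complex.I) * Complex.exp (lam * Complex.I) = 1 := by
    rw [← Complex.exp_add]; simp
  have hre : ∀ z ∈ ball (0 : ℂ) 1, -(1 / 2) < (z * (deriv g z / (c * g z))).re := by
    intro z hz
    have h := hRob z hz
    have e : Complex.exp (-(lam : ℂ) * Complex.I) * (1 + z * deriv g z / g z) =
        Complex.exp (((-lam : ℝ) : ℂ) * Complex.I) +
          ((2 * Real.cos lam : ℝ) : ℂ) * (z * (deriv g z / (c * g z))) := by
      have hgz := hf' z hz
      have e1 : z * deriv g z / g z = c * (z * (deriv g z / (c * g z))) := by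
        field_simp
      rw [e1]
      generalize z * (deriv g z / (c * g z)) = P
      rw [hcdef]
      push_cast
      linear_combination (2 * Complex.cos lam * P) * hexpI
    rw [e, Complex.add_re, Complex.re_ofReal_mul, Complex.exp_ofReal_mul_I_re, Real.cos_neg] at h
    nlinarith
  have hφlt := marx hF hF0 hre
  have hφD : ∀ z ∈ ball (0 : ℂ) 1, HasDerivAt (fun z => Complex.exp (-F z))
      (Complex.exp (-F z) * -(deriv g z / (c * g z))) z := fun z hz => (hF z hz).neg.cexp
  have hslit : ∀ z ∈ ball (0 : ℂ) 1, Complex.exp (-F z) ∈ Complex.slitPlane := by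
    intro z hz
    left
    have h1 := (Complex.re_le_norm (1 - Complex.exp (-F z))).trans_lt (hφlt z hz)
    simp only [Complex.sub_re, Complex.one_re] at h1
    linarith
  have hlogD : ∀ z ∈ ball (0 : ℂ) 1, HasDerivAt (fun z => -Complex.log (Complex.exp (-F z)))
      (deriv g z / (c * g z)) z := by
    intro z hz
    have h : HasDerivAt (fun z => -Complex.log (Complex.exp (-F z)))
      (-(Complex.exp (-F z) * -(deriv g z / (c * g z)) / Complex.exp (-F z))) z :=
      ((hφD z hz).clog (hslit z hz)).neg
    convert h using 1
    rw [mul_div_cancel_left₀ _ (Complex.exp_ne_zero _), neg_neg]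
  have hEq : Set.EqOn F (fun z => -Complex.log (Complex.exp (-F z))) (ball 0 1) :=
    isOpen_ball.eqOn_of_deriv_eq (convex_ball (0 : ℂ) 1).isPreconnected
      (fun z hz => (hF z hz).differentiableAt.differentiableWithinAt)
      (fun z hz => (hlogD z hz).differentiableAt.differentiableWithinAt)
      (fun z hz => by rw [(hF z hz).deriv, (hlogD z hz).deriv])
      (mem_ball_self one_pos) (by simp [hF0])
  have hGD : ∀ z ∈ ball (0 : ℂ) 1, HasDerivAt (fun z => g z * Complex.exp (-(c * F z))) 0 z := by
    intro z hz
    have h : HasDerivAt (fun z => g z * Complex.exp (-(c * F z)))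
      (deriv g z * Complex.exp (-(c * F z)) + g z * (Complex.exp (-(c * F z)) *
        -(c * (deriv g z / (c * g z))))) z := (hgD z hz).mul (((hF z hz).const_mul c).neg.cexp)
    convert h using 1
    have := hf' z hz
    field_simp
    ring
  intro z hz hz0
  have hgz : g z = Complex.exp (c * F z) := by
    have h := isOpen_ball.is_const_of_deriv_eq_zero (convex_ball (0 : ℂ) 1).isPreconnected
      (fun z hz => (hGD z hz).differentiableAt.differentiableWithinAt)
      (fun z hz => (hGD z hz).deriv) hz (mem_ball_self one_pos)
    simp only [hF0, hf'0, mul_zero, neg_zero, Complex.exp_zero, mul_one] at h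
    rw [Complex.exp_neg] at h
    exact (mul_inv_eq_one₀ (Complex.exp_ne_zero _)).1 h
  have hzn : ‖z‖ < 1 := by simpa using hz
  have hw : ‖1 - Complex.exp (-F z)‖ ≤ ‖z‖ :=
    Complex.norm_le_norm_of_mapsTo_ball (f := fun z => 1 - Complex.exp (-F z)) (R := 1)
      (fun z hz => ((hφD z hz).const_sub 1).differentiableAt.differentiableWithinAt)
      (fun z hz => by simpa using (hφlt z hz).le) (by simp [hF0]) hzn
  obtain ⟨hpos, hext⟩ := extremal_bound lam ‖z‖ hlam (norm_pos_iff.2 hz0) hzn _ hw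
  rw [sub_sub_cancel] at hext
  have hFz : F z = -Complex.log (Complex.exp (-F z)) := hEq hz
  have hcF : (c * F z).re = 2 * Real.cos lam * (Real.sin lam * (Complex.exp (-F z)).arg -
      Real.cos lam * Real.log ‖Complex.exp (-F z)‖) := by
    have e : c = ((2 * Real.cos lam : ℝ) : ℂ) * Complex.exp (lam * Complex.I) := by
      rw [hcdef]; push_cast; ring
    rw [e, mul_assoc, Complex.re_ofReal_mul, Complex.mul_re, Complex.exp_ofReal_mul_I_re,
      Complex.exp_ofReal_mul_I_im]
    rw [← Complex.log_re, ← Complex.log_im]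
    rw [eq_neg_iff_add_eq_zero, add_comm, ← eq_neg_iff_add_eq_zero] at hFz
    rw [hFz, Complex.neg_re, Complex.neg_im]; ring
  rw [hgz, Complex.norm_exp, hcF, Real.rpow_def_of_pos hpos, ← Real.exp_sub, Real.exp_le_exp,
    Real.sin_two_mul]
  nlinarith
end

section
/- Let λ ∈ (−π/2, π/2) and let f be a λ-Robertson function. Then for every z ∈ 𝔻 with |z| = r, 0 < r < 1, one has |f(z)| ≤ ∫₀^r exp(sin(2λ) · arcsin(t sin λ)) / (√(1 − t² sin² λ) − t cos λ)^{2 cos² λ} dt. -/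
open Metric

lemma rob_left_max {φ : ℝ → ℝ} {D : ℝ} (h : HasDerivAt φ D 0)
    (hm : ∀ s ≤ 0, φ s ≤ φ 0) : 0 ≤ D := by
  have h1 := (hasDerivWithinAt_iff_tendsto_slope' (s := Set.Iio (0:ℝ)) (by simp)).1
    (h.hasDerivWithinAt (s := Set.Iio (0:ℝ)))
  refine ge_of_tendsto h1 ?_
  filter_upwards [self_mem_nhdsWithin] with s hs
  rw [slope_def_field]
  have hs' : s < 0 := hs
  have := hm s hs'.le
  exact div_nonneg_of_nonpos (by linarith) (by linarith)

lemma rob_log_norm {g : ℝ → ℂ} {g' : ℂ} {x : ℝ} (h : HasDerivAt g g' x) (h0 : g x ≠ 0) :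
    HasDerivAt (fun s => Real.log ‖g s‖) (g' / g x).re x := by
  have h1 := h.norm_sq.log (by simpa using h0)
  have h2 := h1.const_mul (1/2)
  have hn : ‖g x‖ ≠ 0 := by simpa using h0
  have hfun : (fun s => Real.log ‖g s‖) = fun y => 1 / 2 * Real.log (‖g y‖ ^ 2) := by
    funext s
    simp [Real.log_pow]
  rw [hfun]
  refine h2.congr_deriv ?_
  have e : g' / g x = (starRingEnd ℂ (g x) * g') / ((‖g x‖ ^ 2 : ℝ) : ℂ) := by
    have hc : starRingEnd ℂ (g x) ≠ 0 := by simpa using h0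
    rw [← Complex.normSq_eq_norm_sq, Complex.normSq_eq_conj_mul_self]
    field_simp
  rw [e, Complex.div_ofReal_re, Complex.inner, mul_comm (g')]
  field_simp

lemma rob_base_pos {s c t : ℝ} (hsc : s ^ 2 + c ^ 2 = 1) (ht : 0 ≤ t) (ht1 : t < 1) :
    0 < 1 - t ^ 2 * s ^ 2 ∧ 0 < Real.sqrt (1 - t ^ 2 * s ^ 2) - t * c := by
  have h1 : t ^ 2 < 1 := by nlinarith
  have h2 : 0 < 1 - t ^ 2 * s ^ 2 := by nlinarith [sq_nonneg s, sq_nonneg c]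
  refine ⟨h2, ?_⟩
  have := Real.lt_sqrt_of_sq_lt (x := t * c) (y := 1 - t ^ 2 * s ^ 2) (by nlinarith)
  linarith

noncomputable def robB (lam t : ℝ) : ℝ :=
  Real.sin (2 * lam) * Real.arcsin (t * Real.sin lam) -
    2 * Real.cos lam ^ 2 * Real.log (Real.sqrt (1 - t ^ 2 * Real.sin lam ^ 2) - t * Real.cos lam)

lemma robB_zero (lam : ℝ) : robB lam 0 = 0 := by simp [robB]

lemma rob_alg {s c t q : ℝ} (hq : q ≠ 0) (hb : q - t * c ≠ 0) (hsc : s ^ 2 + c ^ 2 = 1) :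
    2 * s * c * (1 / q * s) - 2 * c ^ 2 * ((-(2 * t * s ^ 2) / (2 * q) - c) / (q - t * c)) =
      2 * c / (q - t * c) := by
  obtain ⟨b, hbe⟩ : ∃ b, b = q - t * c := ⟨_, rfl⟩
  rw [← hbe] at hb ⊢
  field_simp
  rw [hbe]
  linear_combination c * q * hsc

lemma robB_deriv (lam t : ℝ) (ht : 0 ≤ t) (ht1 : t < 1) :
    HasDerivAt (robB lam)
      (2 * Real.cos lam / (Real.sqrt (1 - t ^ 2 * Real.sin lam ^ 2) - t * Real.cos lam)) t := by
  have hsc := Real.sin_sq_add_cos_sq lam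
  obtain ⟨hp, hb⟩ := rob_base_pos hsc ht ht1
  unfold robB
  rw [Real.sin_two_mul]
  set s := Real.sin lam
  set c := Real.cos lam
  have hq : 0 < Real.sqrt (1 - t ^ 2 * s ^ 2) := Real.sqrt_pos.2 hp
  have hqs := Real.sq_sqrt hp.le
  have hA : HasDerivAt (fun t : ℝ => Real.arcsin (t * s))
      (1 / Real.sqrt (1 - t ^ 2 * s ^ 2) * s) t := by
    have e : HasDerivAt (fun t : ℝ => t * s) s t := by simpa using (hasDerivAt_id t).mul_const s
    have := (Real.hasDerivAt_arcsin (x := t * s) (by intro h; nlinarith) (by intro h; nlinarith)).comp t e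
    rw [mul_pow] at this
    exact this
  have hS : HasDerivAt (fun t : ℝ => Real.sqrt (1 - t ^ 2 * s ^ 2))
      (-(2 * t * s ^ 2) / (2 * Real.sqrt (1 - t ^ 2 * s ^ 2))) t := by
    have e : HasDerivAt (fun t : ℝ => 1 - t ^ 2 * s ^ 2) (-(2 * t * s ^ 2)) t := by
      have := ((hasDerivAt_pow 2 t).mul_const (s ^ 2)).const_sub 1
      simpa using this
    exact e.sqrt hp.ne'
  have hc : HasDerivAt (fun t : ℝ => t * c) c t := by simpa using (hasDerivAt_id t).mul_const c
  have hL := ((hS.sub hc).log hb.ne').const_mul (2 * c ^ 2)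
  have := (hA.const_mul (2 * s * c)).sub hL
  refine this.congr_deriv ?_
  change 2 * s * c * (1 / Real.sqrt (1 - t ^ 2 * s ^ 2) * s) -
    2 * c ^ 2 * ((-(2 * t * s ^ 2) / (2 * Real.sqrt (1 - t ^ 2 * s ^ 2)) - c) /
      (Real.sqrt (1 - t ^ 2 * s ^ 2) - t * c)) = _
  exact rob_alg hq.ne' hb.ne' hsc

lemma rob_quad {c s r x q : ℝ} (hc : 0 < c) (hsc : s ^ 2 + c ^ 2 = 1) (hr : 0 < r) (hr1 : r < 1)
    (hq : q ^ 2 = 1 - r ^ 2 * s ^ 2) (hb : 0 < q - r * c)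
    (h : x ^ 2 ≤ r ^ 2 * (x ^ 2 + 4 * c ^ 2 + 4 * x * c ^ 2)) :
    x ≤ r * (2 * c / (q - r * c)) := by
  set X := r * (2 * c / (q - r * c)) with hX
  have hXp : 0 < X := by positivity
  have hXe : X * (q - r * c) = 2 * c * r := by rw [hX]; field_simp
  have hs : s ^ 2 = 1 - c ^ 2 := by linarith
  rw [hs] at hq
  have hr2 : 0 < 1 - r ^ 2 := by nlinarith
  -- X (1 - r²) = 2 c r (q + r c)
  have h1 : X * (1 - r ^ 2) = 2 * c * r * (q + r * c) := by
    linear_combination (q + r * c) * hXe - X * hq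
  have h2 : X ^ 2 * (1 - r ^ 2) = r ^ 2 * (4 * c ^ 2 + 4 * X * c ^ 2) := by
    linear_combination X * h1 + 2 * c * r * hXe
  by_contra hlt
  push Not at hlt
  have h3 : x ^ 2 * (1 - r ^ 2) ≤ r ^ 2 * (4 * c ^ 2 + 4 * x * c ^ 2) := by linarith
  -- multiply out
  have h4 : (x - X) * ((x * X) * (1 - r ^ 2) + 4 * r ^ 2 * c ^ 2) ≤ 0 := by
    have : (x - X) * ((x * X) * (1 - r ^ 2) + 4 * r ^ 2 * c ^ 2) =
      X * (x ^ 2 * (1 - r ^ 2) - r ^ 2 * (4 * c ^ 2 + 4 * x * c ^ 2)) := by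
      linear_combination (-x) * h2
    rw [this]
    exact mul_nonpos_of_nonneg_of_nonpos hXp.le (by linarith)
  have h5 : 0 < x := hXp.trans hlt
  have h6 : 0 < (x - X) * ((x * X) * (1 - r ^ 2) + 4 * r ^ 2 * c ^ 2) := by
    have : 0 < x - X := by linarith
    positivity
  linarith

/-- Schwarz-type estimate for a function with positive real part. -/
lemma rob_schwarz {F : ℂ → ℂ} (hF : DifferentiableOn ℂ F (ball 0 1))
    (hpos : ∀ z ∈ ball (0 : ℂ) 1, 0 < (F z).re) {z : ℂ} (hz : z ∈ ball (0 : ℂ) 1) :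
    ‖F z - F 0‖ ≤ ‖z‖ * ‖F z + starRingEnd ℂ (F 0)‖ := by
  have h0 := hpos 0 (by simp)
  have hne : ∀ w ∈ ball (0 : ℂ) 1, F w + starRingEnd ℂ (F 0) ≠ 0 := by
    intro w hw h
    have := congrArg Complex.re h
    simp at this
    linarith [hpos w hw]
  have key := Complex.norm_le_norm_of_mapsTo_ball (R := 1)
    (f := fun w => (F w - F 0) / (F w + starRingEnd ℂ (F 0))) (z := z)
    ((hF.sub_const _).div (hF.add_const _) hne) ?_ (by simp) (by simpa using hz)
  · rw [norm_div, div_le_iff₀ (norm_pos_iff.2 (hne z hz))] at key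
    exact key
  · intro w hw
    have hw' := hpos w hw
    simp only [mem_closedBall, dist_zero_right, norm_div]
    refine div_le_one_of_le₀ ?_ (norm_nonneg _)
    rw [← sq_le_sq₀ (norm_nonneg _) (norm_nonneg _), ← Complex.normSq_eq_norm_sq,
      ← Complex.normSq_eq_norm_sq, Complex.normSq_apply, Complex.normSq_apply]
    simp
    nlinarith

lemma rob_deriv_bound (lam : ℝ)
    (hlam : lam ∈ Set.Ioo (-(Real.pi / 2)) (Real.pi / 2))
    (f : ℂ → ℂ)
    (hf : DifferentiableOn ℂ f (ball (0 : ℂ) 1))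
    (hf'0 : deriv f 0 = 1)
    (hf' : ∀ z ∈ ball (0 : ℂ) 1, deriv f z ≠ 0)
    (hRob : ∀ z ∈ ball (0 : ℂ) 1,
      0 < (Complex.exp (-(lam : ℂ) * Complex.I) *
        (1 + z * deriv (deriv f) z / deriv f z)).re)
    (z : ℂ) (hz : z ∈ ball (0 : ℂ) 1) :
    Real.log ‖deriv f z‖ ≤ robB lam ‖z‖ := by
  have hc : 0 < Real.cos lam := Real.cos_pos_of_mem_Ioo hlam
  have hsc := Real.sin_sq_add_cos_sq lam
  have hd1 : DifferentiableOn ℂ (deriv f) (ball 0 1) := hf.deriv isOpen_ball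
  have hd2 : DifferentiableOn ℂ (deriv (deriv f)) (ball 0 1) := hd1.deriv isOpen_ball
  have hFd : DifferentiableOn ℂ (fun z => Complex.exp (-(lam : ℂ) * Complex.I) *
        (1 + z * deriv (deriv f) z / deriv f z)) (ball 0 1) :=
    (((differentiableOn_id.mul hd2).div hd1 hf').const_add 1).const_mul _
  have he : Complex.exp (-(lam : ℂ) * Complex.I) = ⟨Real.cos lam, -Real.sin lam⟩ := by
    rw [← Complex.ofReal_neg, Complex.exp_mul_I, ← Complex.ofReal_cos, ← Complex.ofReal_sin,
      Real.cos_neg, Real.sin_neg]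
    apply Complex.ext <;> simp [-Complex.ofReal_cos, -Complex.ofReal_sin]
  -- key pointwise bound
  have hpt : ∀ w ∈ ball (0 : ℂ) 1, w ≠ 0 → (w * deriv (deriv f) w / deriv f w).im = 0 →
      (w * deriv (deriv f) w / deriv f w).re ≤
        ‖w‖ * (2 * Real.cos lam /
          (Real.sqrt (1 - ‖w‖ ^ 2 * Real.sin lam ^ 2) - ‖w‖ * Real.cos lam)) := by
    intro w hw hw0 him
    have hw1 : ‖w‖ < 1 := by simpa using hw
    have hwp : 0 < ‖w‖ := norm_pos_iff.2 hw0
    obtain ⟨hp, hb⟩ := rob_base_pos hsc hwp.le hw1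
    have hS := rob_schwarz hFd hRob hw
    refine rob_quad hc hsc hwp hw1 (Real.sq_sqrt hp.le) hb ?_
    set x := (w * deriv (deriv f) w / deriv f w).re with hx
    have hxe : w * deriv (deriv f) w / deriv f w = (x : ℂ) := by
      apply Complex.ext <;> simp [hx, him]
    generalize ‖w‖ = r at hwp hS ⊢
    rw [← sq_le_sq₀ (norm_nonneg _) (by positivity), mul_pow, ← Complex.normSq_eq_norm_sq,
      ← Complex.normSq_eq_norm_sq, Complex.normSq_apply, Complex.normSq_apply] at hS
    simp only [hxe, he] at hS
    simp at hS
    have hs : Real.sin lam ^ 2 = 1 - Real.cos lam ^ 2 := by linarith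
    ring_nf at hS
    simp only [hs] at hS
    ring_nf at hS ⊢
    linarith
  have hcont : ∀ ε : ℝ, 0 < ε → Real.log ‖deriv f z‖ ≤ robB lam ‖z‖ + ε * ‖z‖ := by
    intro ε hε
    have hz1 : ‖z‖ < 1 := by simpa using hz
    set v : ℂ → ℝ := fun w => Real.log ‖deriv f w‖ - robB lam ‖w‖ - ε * ‖w‖ with hv
    have hsub : closedBall (0 : ℂ) ‖z‖ ⊆ ball 0 1 := closedBall_subset_ball hz1
    have hvc : ContinuousOn v (closedBall 0 ‖z‖) := by
      refine ContinuousOn.sub (ContinuousOn.sub ?_ ?_) (by fun_prop)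
      · exact ((hd1.continuousOn.mono hsub).norm).log
          (fun w hw => norm_ne_zero_iff.2 (hf' w (hsub hw)))
      · intro w hw
        have hw1 : ‖w‖ < 1 := by simpa using hsub hw
        exact ((robB_deriv lam ‖w‖ (norm_nonneg _) hw1).continuousAt.comp (f := fun w : ℂ => ‖w‖)
          continuous_norm.continuousAt).continuousWithinAt
    obtain ⟨w, hw, hmax⟩ := (isCompact_closedBall (0 : ℂ) ‖z‖).exists_isMaxOn
      ⟨0, by simp⟩ hvc
    have hzmax : v z ≤ v w := hmax (by simp)
    suffices hw0 : w = 0 by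
      subst hw0
      have : v 0 = 0 := by simp [hv, hf'0, robB_zero]
      rw [this] at hzmax
      simp only [hv] at hzmax
      linarith
    by_contra hw0
    have hwb := hsub hw
    have hw1 : ‖w‖ < 1 := by simpa using hwb
    have hwz : ‖w‖ ≤ ‖z‖ := by simpa using hw
    have hD : HasDerivAt (deriv f) (deriv (deriv f) w) w :=
      (hd1.differentiableAt (isOpen_ball.mem_nhds hwb)).hasDerivAt
    have hpath : ∀ a : ℂ, HasDerivAt (fun s : ℝ => Real.log ‖deriv f (w * Complex.exp (s * a))‖)
        (a * (w * deriv (deriv f) w / deriv f w)).re 0 := by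
      intro a
      have e1 : HasDerivAt (fun s : ℝ => w * Complex.exp (s * a)) (w * a) 0 := by
        have e0 : HasDerivAt (fun s : ℝ => (s : ℂ) * a) a 0 := by
          simpa using (Complex.ofRealCLM.hasDerivAt (x := (0:ℝ))).mul_const a
        simpa using e0.cexp.const_mul w
      have e2 : HasDerivAt (fun s : ℝ => deriv f (w * Complex.exp (s * a)))
          (deriv (deriv f) w * (w * a)) 0 := by
        refine HasDerivAt.comp (h₂ := deriv f) (0:ℝ) ?_ e1
        simpa using hD
      have e3 := rob_log_norm e2 (by simpa using hf' w hwb)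
      refine e3.congr_deriv ?_
      congr 1
      simp
      ring
    have him : (w * deriv (deriv f) w / deriv f w).im = 0 := by
      have h1 := hpath Complex.I
      have h2 : IsLocalMax (fun s : ℝ => Real.log ‖deriv f (w * Complex.exp (s * Complex.I))‖) 0 := by
        refine Filter.Eventually.of_forall fun s => ?_
        have hn : ‖w * Complex.exp (s * Complex.I)‖ = ‖w‖ := by
          rw [norm_mul, Complex.norm_exp_ofReal_mul_I, mul_one]
        have h3 : v (w * Complex.exp (s * Complex.I)) ≤ v w := hmax (by simpa [hn] using hwz)
        simp only [hv, hn] at h3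
        simp
        linarith
      have := h2.hasDerivAt_eq_zero h1
      rw [Complex.I_mul_re] at this
      linarith
    have hre := hpt w hwb hw0 him
    have hr : HasDerivAt (fun s : ℝ => ‖w‖ * Real.exp s) ‖w‖ 0 := by
      simpa using (Real.hasDerivAt_exp 0).const_mul ‖w‖
    have hB : HasDerivAt (fun s : ℝ => robB lam (‖w‖ * Real.exp s)) _ 0 :=
      HasDerivAt.comp (h₂ := robB lam) (0:ℝ)
        (by simpa using robB_deriv lam ‖w‖ (norm_nonneg _) hw1) hr
    have hφ := ((hpath 1).sub hB).sub (hr.const_mul ε)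
    have hge := rob_left_max hφ (by
      intro s hs
      have hn : ‖w * Complex.exp (s * 1)‖ = ‖w‖ * Real.exp s := by
        rw [norm_mul, mul_one, Complex.norm_exp]; simp
      have hle : ‖w‖ * Real.exp s ≤ ‖z‖ :=
        (mul_le_of_le_one_right (norm_nonneg _) (Real.exp_le_one_iff.2 hs)).trans hwz
      have h3 : v (w * Complex.exp (s * 1)) ≤ v w := hmax (by
        rw [mem_closedBall, dist_zero_right, hn]; exact hle)
      simp only [hv, hn] at h3
      simpa using h3)
    have hwp : 0 < ‖w‖ := norm_pos_iff.2 hw0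
    have : 0 < ε * ‖w‖ := by positivity
    rw [one_mul] at hge
    linarith
  refine le_of_forall_pos_le_add fun ε hε => (hcont ε hε).trans ?_
  have hz1 : ‖z‖ < 1 := by simpa using hz
  nlinarith


/-- Integral growth bound for λ-Robertson functions:
`|f(z)| ≤ ∫₀^r exp(sin(2λ)·arcsin(t sin λ)) / (√(1 − t² sin² λ) − t cos λ)^(2 cos² λ) dt`
for `|z| = r`, `0 < r < 1`. -/
theorem robertson_integral_bound (lam : ℝ)
    (hlam : lam ∈ Set.Ioo (-(Real.pi / 2)) (Real.pi / 2))
    (f : ℂ → ℂ)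
    (hf : DifferentiableOn ℂ f (ball (0 : ℂ) 1))
    (hf0 : f 0 = 0) (hf'0 : deriv f 0 = 1)
    (hf' : ∀ z ∈ ball (0 : ℂ) 1, deriv f z ≠ 0)
    (hRob : ∀ z ∈ ball (0 : ℂ) 1,
      0 < (Complex.exp (-(lam : ℂ) * Complex.I) *
        (1 + z * deriv (deriv f) z / deriv f z)).re) :
    ∀ z ∈ ball (0 : ℂ) 1, z ≠ 0 →
      ‖f z‖ ≤
        ∫ t in (0 : ℝ)..‖z‖,
          Real.exp (Real.sin (2 * lam) * Real.arcsin (t * Real.sin lam)) /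
            (Real.sqrt (1 - t ^ 2 * Real.sin lam ^ 2) -
              t * Real.cos lam) ^ (2 * Real.cos lam ^ 2) := by
  intro z hz hz0
  have hz1 : ‖z‖ < 1 := by simpa using hz
  have hzp : 0 < ‖z‖ := norm_pos_iff.2 hz0
  have hsc := Real.sin_sq_add_cos_sq lam
  set u : ℂ := z / ‖z‖ with hu
  have hun : ‖u‖ = 1 := by simp [hu, hz0]
  have hnorm : ∀ t : ℝ, 0 ≤ t → ‖(t : ℂ) * u‖ = t := by
    intro t ht
    rw [norm_mul, hun, mul_one, Complex.norm_real, Real.norm_of_nonneg ht]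
  have hmem : ∀ t ∈ Set.Icc (0 : ℝ) ‖z‖, (t : ℂ) * u ∈ ball (0 : ℂ) 1 := by
    intro t ht
    rw [mem_ball_zero_iff, hnorm t ht.1]
    exact ht.2.trans_lt hz1
  have hd1 : DifferentiableOn ℂ (deriv f) (ball 0 1) := hf.deriv isOpen_ball
  have hder : ∀ t ∈ Set.uIcc (0 : ℝ) ‖z‖,
      HasDerivAt (fun t : ℝ => f ((t : ℂ) * u)) (deriv f ((t : ℂ) * u) * u) t := by
    intro t ht
    rw [Set.uIcc_of_le hzp.le] at ht
    have e0 : HasDerivAt (fun s : ℝ => (s : ℂ) * u) u t := by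
      simpa using (Complex.ofRealCLM.hasDerivAt (x := t)).mul_const u
    exact HasDerivAt.comp (h₂ := f) t
      (hf.differentiableAt (isOpen_ball.mem_nhds (hmem t ht))).hasDerivAt e0
  have hci : ContinuousOn (fun t : ℝ => deriv f ((t : ℂ) * u) * u) (Set.uIcc (0 : ℝ) ‖z‖) := by
    rw [Set.uIcc_of_le hzp.le]
    refine ContinuousOn.mul ?_ continuousOn_const
    exact hd1.continuousOn.comp (f := fun t : ℝ => (t : ℂ) * u) (by fun_prop) hmem
  have hint := intervalIntegral.integral_eq_sub_of_hasDerivAt hder hci.intervalIntegrable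
  have hend : ((‖z‖ : ℝ) : ℂ) * u = z := by
    have : ((‖z‖ : ℝ) : ℂ) ≠ 0 := by simpa using hz0
    rw [hu]; field_simp
  rw [hend] at hint
  simp only [Complex.ofReal_zero, zero_mul, hf0, sub_zero] at hint
  rw [← hint]
  refine intervalIntegral.norm_integral_le_of_norm_le hzp.le ?_ ?_
  · refine Filter.Eventually.of_forall fun t ht => ?_
    have htm := hmem t ⟨ht.1.le, ht.2⟩
    have hb := rob_deriv_bound lam hlam f hf hf'0 hf' hRob _ htm
    rw [hnorm t ht.1.le] at hb
    obtain ⟨-, hbp⟩ := rob_base_pos hsc ht.1.le (ht.2.trans_lt hz1)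
    rw [norm_mul, hun, mul_one, Real.rpow_def_of_pos hbp, ← Real.exp_sub]
    rw [← Real.log_le_iff_le_exp (norm_pos_iff.2 (hf' _ htm))]
    refine hb.trans_eq ?_
    rw [robB]
    ring
  · apply ContinuousOn.intervalIntegrable
    rw [Set.uIcc_of_le hzp.le]
    have hpos : ∀ t ∈ Set.Icc (0 : ℝ) ‖z‖, 0 < Real.sqrt (1 - t ^ 2 * Real.sin lam ^ 2) -
        t * Real.cos lam := fun t ht => (rob_base_pos hsc ht.1 (ht.2.trans_lt hz1)).2
    refine ContinuousOn.div ?_ ?_ ?_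
    · exact (Real.continuous_exp.comp (continuous_const.mul
        (Real.continuous_arcsin.comp (continuous_id.mul continuous_const)))).continuousOn
    · refine ContinuousOn.rpow_const ?_ (fun t ht => Or.inl (hpos t ht).ne')
      fun_prop
    · exact fun t ht => (Real.rpow_pos_of_pos (hpos t ht) _).ne'
end

section
/- Let λ ∈ (−π/2, π/2) and let p be analytic on the unit disk 𝔻 with p(0) = 1 and Re(e^{−iλ} p(z)) > 0 for all z ∈ 𝔻. Then for all z ∈ 𝔻 with |z| = r, |p(z) − (1/(1 − r²) + r² e^{2iλ}/(1 − r²))| ≤ 2 r cos λ / (1 − r²). -/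
open Metric

/-- If `p` is analytic on 𝔻 with `p(0) = 1` and `Re(e^{−iλ} p(z)) > 0` on 𝔻, then
`|p(z) − (1/(1 − r²) + r² e^{2iλ}/(1 − r²))| ≤ 2 r cos λ / (1 − r²)` for `|z| = r`. -/
theorem tilted_herglotz_estimate (lam : ℝ)
    (hlam : lam ∈ Set.Ioo (-(Real.pi / 2)) (Real.pi / 2))
    (p : ℂ → ℂ)
    (hp : DifferentiableOn ℂ p (ball (0 : ℂ) 1))
    (hp0 : p 0 = 1)
    (hre : ∀ z ∈ ball (0 : ℂ) 1, 0 < (Complex.exp (-(lam : ℂ) * Complex.I) * p z).re) :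
    ∀ z ∈ ball (0 : ℂ) 1,
      ‖p z -
          (1 / (1 - ((‖z‖ : ℝ) : ℂ) ^ 2) +
            ((‖z‖ : ℝ) : ℂ) ^ 2 * Complex.exp (2 * (lam : ℂ) * Complex.I) /
              (1 - ((‖z‖ : ℝ) : ℂ) ^ 2))‖ ≤
        2 * ‖z‖ * Real.cos lam / (1 - ‖z‖ ^ 2) := by
  have hc : 0 < Real.cos lam := Real.cos_pos_of_mem_Ioo ⟨hlam.1, hlam.2⟩
  have hcs := Real.sin_sq_add_cos_sq lam
  set c := Real.cos lam with hcdef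
  set s := Real.sin lam with hsdef
  have hE : Complex.exp (2 * (lam : ℂ) * Complex.I) = ⟨c ^ 2 - s ^ 2, 2 * s * c⟩ := by
    have h : (2 * (lam : ℂ) * Complex.I) = ((2 * lam : ℝ) : ℂ) * Complex.I := by push_cast; ring
    rw [h]
    apply Complex.ext
    · rw [Complex.exp_ofReal_mul_I_re, Real.cos_two_mul']
    · rw [Complex.exp_ofReal_mul_I_im, Real.sin_two_mul]
  have hA : Complex.exp (-(lam : ℂ) * Complex.I) = ⟨c, -s⟩ := by
    have h : (-(lam : ℂ) * Complex.I) = ((-lam : ℝ) : ℂ) * Complex.I := by push_cast; ring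
    rw [h]
    apply Complex.ext
    · rw [Complex.exp_ofReal_mul_I_re, Real.cos_neg]
    · rw [Complex.exp_ofReal_mul_I_im, Real.sin_neg]
  rw [hE]
  rw [hA] at hre
  set E : ℂ := ⟨c ^ 2 - s ^ 2, 2 * s * c⟩ with hEdef
  have hlt : ∀ z ∈ ball (0 : ℂ) 1, ‖p z - 1‖ < ‖p z + E‖ := by
    intro z hz
    have h := hre z hz
    simp only [Complex.mul_re] at h
    have h2 := mul_pos hc h
    apply lt_of_pow_lt_pow_left₀ 2 (norm_nonneg _)
    rw [Complex.sq_norm, Complex.sq_norm, Complex.normSq_apply, Complex.normSq_apply]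
    simp only [Complex.sub_re, Complex.sub_im, Complex.add_re, Complex.add_im, Complex.one_re,
      Complex.one_im, hEdef]
    have hs2 : s ^ 2 = 1 - c ^ 2 := by linarith
    have key : ((p z).re + (c ^ 2 - s ^ 2)) * ((p z).re + (c ^ 2 - s ^ 2)) +
        ((p z).im + 2 * s * c) * ((p z).im + 2 * s * c) -
        (((p z).re - 1) * ((p z).re - 1) + ((p z).im - 0) * ((p z).im - 0)) =
        4 * (c * (c * (p z).re - -s * (p z).im)) := by
      linear_combination ((s ^ 2 + c ^ 2 + 1) - 2 * (p z).re) * hcs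
    linarith
  have hne : ∀ z ∈ ball (0 : ℂ) 1, p z + E ≠ 0 := fun z hz =>
    norm_pos_iff.mp ((norm_nonneg _).trans_lt (hlt z hz))
  intro z hz
  have hz1 : ‖z‖ < 1 := by simpa using hz
  have hS : ‖(p z - 1) / (p z + E)‖ ≤ ‖z‖ := by
    refine Complex.norm_le_norm_of_mapsTo_ball (f := fun z => (p z - 1) / (p z + E)) (R := 1)
      ((hp.sub_const 1).div (hp.add_const E) hne) ?_ (by simp [hp0]) hz1
    intro w hw
    rw [mem_closedBall_zero_iff, norm_div]
    exact div_le_one_of_le₀ (hlt w hw).le (norm_nonneg _)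
  rw [norm_div, div_le_iff₀ (norm_pos_iff.mpr (hne z hz))] at hS
  set r := ‖z‖ with hr
  have hr0 : 0 ≤ r := norm_nonneg _
  have hd : 0 < 1 - r ^ 2 := by nlinarith
  have hS2 := pow_le_pow_left₀ (norm_nonneg _) hS 2
  rw [mul_pow, Complex.sq_norm (p z - 1), Complex.sq_norm (p z + E), Complex.normSq_apply,
    Complex.normSq_apply] at hS2
  simp only [Complex.sub_re, Complex.sub_im, Complex.add_re, Complex.add_im, Complex.one_re,
      Complex.one_im, hEdef] at hS2
  have hdC : (1 - (r : ℂ) ^ 2) ≠ 0 := by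
    have := hd.ne'
    exact_mod_cast this
  have heq : p z - (1 / (1 - (r : ℂ) ^ 2) + (r : ℂ) ^ 2 * E / (1 - (r : ℂ) ^ 2)) =
      (((1 - r ^ 2 : ℝ) : ℂ) * p z - (1 + ((r ^ 2 : ℝ) : ℂ) * E)) / ((1 - r ^ 2 : ℝ) : ℂ) := by
    push_cast
    field_simp
  rw [heq, norm_div, Complex.norm_real, Real.norm_of_nonneg hd.le]
  apply div_le_div_of_nonneg_right _ hd.le
  apply le_of_sq_le_sq _ (by positivity)
  rw [Complex.sq_norm, Complex.normSq_apply]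
  simp only [Complex.sub_re, Complex.sub_im, Complex.add_re, Complex.add_im, Complex.one_re,
      Complex.one_im, Complex.re_ofReal_mul, Complex.im_ofReal_mul, hEdef]
  generalize (p z).re = u at *
  generalize (p z).im = v at *
  have h3 := mul_le_mul_of_nonneg_left hS2 hd.le
  have hs2 : s ^ 2 = 1 - c ^ 2 := by linarith
  have key : ((1 - r ^ 2) * u - (1 + r ^ 2 * (c ^ 2 - s ^ 2))) *
      ((1 - r ^ 2) * u - (1 + r ^ 2 * (c ^ 2 - s ^ 2))) +
      ((1 - r ^ 2) * v - (0 + r ^ 2 * (2 * s * c))) *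
      ((1 - r ^ 2) * v - (0 + r ^ 2 * (2 * s * c))) - (2 * r * c) ^ 2 =
      (1 - r ^ 2) * ((u - 1) * (u - 1) + (v - 0) * (v - 0)) -
      (1 - r ^ 2) * (r ^ 2 * ((u + (c ^ 2 - s ^ 2)) * (u + (c ^ 2 - s ^ 2)) +
        (v + 2 * s * c) * (v + 2 * s * c))) := by
    linear_combination (r ^ 2 * (s ^ 2 + c ^ 2 + 1) - 2 * r ^ 2) * hcs
  linarith
end

section
/- Let λ ∈ (−π/2, π/2) with cos λ > 1/√2 and λ ≠ 0, and let f_λ(z) = ((1 − z)^{1 − 2 e^{iλ} cos λ} − 1)/(2 e^{iλ} cos λ − 1) on the unit disk 𝔻 (principal branch). Then f_λ is unbounded on 𝔻: sup_{z ∈ 𝔻} |f_λ(z)| = ∞. In particular, |f_λ(r)| → ∞ as r → 1⁻ along the real axis, since Re(1 − 2 e^{iλ} cos λ) = 1 − 2 cos² λ < 0. -/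
open Metric

/-- If `cos λ > 1/√2` and `λ ≠ 0`, the extremal function
`f_λ(z) = ((1 − z)^{1 − 2e^{iλ}cos λ} − 1)/(2e^{iλ}cos λ − 1)` is unbounded on 𝔻;
in particular `|f_λ(r)| → ∞` as `r → 1⁻` along the real axis. -/
theorem extremal_unbounded (lam : ℝ)
    (hlam : lam ∈ Set.Ioo (-(Real.pi / 2)) (Real.pi / 2)) (hlam0 : lam ≠ 0)
    (hcos : 1 / Real.sqrt 2 < Real.cos lam)
    (flam : ℂ → ℂ)
    (hdef : ∀ z : ℂ, flam z =
      ((1 - z) ^ ((1 : ℂ) - 2 * Complex.exp ((lam : ℂ) * Complex.I) * ((Real.cos lam : ℝ) : ℂ)) - 1) /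
        (2 * Complex.exp ((lam : ℂ) * Complex.I) * ((Real.cos lam : ℝ) : ℂ) - 1)) :
    (∀ M : ℝ, ∃ z ∈ ball (0 : ℂ) 1, M < ‖flam z‖) ∧
    Filter.Tendsto (fun r : ℝ => ‖flam ((r : ℝ) : ℂ)‖)
      (nhdsWithin 1 (Set.Iio 1)) Filter.atTop := by
  set d : ℂ := 2 * Complex.exp ((lam : ℂ) * Complex.I) * ((Real.cos lam : ℝ) : ℂ) - 1 with hd
  have hre : d.re = 2 * Real.cos lam ^ 2 - 1 := by
    rw [hd, Complex.exp_mul_I, ← Complex.ofReal_cos, ← Complex.ofReal_sin]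
    simp [-Complex.ofReal_cos, -Complex.ofReal_sin]
    ring
  have hpos : 0 < d.re := by
    have h2 : (1 / Real.sqrt 2) ^ 2 < Real.cos lam ^ 2 :=
      pow_lt_pow_left₀ hcos (by positivity) (by norm_num)
    rw [div_pow, Real.sq_sqrt (by norm_num)] at h2
    rw [hre]
    linarith
  have hd0 : 0 < ‖d‖ := by
    rw [norm_pos_iff]
    intro h
    rw [h] at hpos
    simp at hpos
  have hw : (1 : ℂ) - 2 * Complex.exp ((lam : ℂ) * Complex.I) * ((Real.cos lam : ℝ) : ℂ) = -d := by
    rw [hd]; ring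
  rw [hw] at hdef
  have hT : Filter.Tendsto (fun r : ℝ => ‖flam ((r : ℝ) : ℂ)‖)
      (nhdsWithin 1 (Set.Iio 1)) Filter.atTop := by
    have h1 : Filter.Tendsto (fun r : ℝ => 1 - r) (nhdsWithin 1 (Set.Iio 1))
        (nhdsWithin 0 (Set.Ioi 0)) := by
      refine tendsto_nhdsWithin_iff.2 ⟨?_, ?_⟩
      · have : Continuous (fun r : ℝ => 1 - r) := by fun_prop
        have h := this.tendsto 1
        rw [sub_self] at h
        exact h.mono_left nhdsWithin_le_nhds
      · filter_upwards [self_mem_nhdsWithin] with r hr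
        have : r < 1 := hr
        simpa using this
    have h2 : Filter.Tendsto (fun r : ℝ => (1 - r) ^ (-d.re)) (nhdsWithin 1 (Set.Iio 1))
        Filter.atTop := (tendsto_rpow_neg_nhdsGT_zero (neg_lt_zero.2 hpos)).comp h1
    have h3 := (Filter.tendsto_atTop_add_const_right _ (-1 : ℝ) h2).atTop_div_const hd0
    refine Filter.tendsto_atTop_mono' _ ?_ h3
    filter_upwards [self_mem_nhdsWithin] with r hr
    have hr1 : 0 < 1 - r := sub_pos.2 hr
    rw [hdef, norm_div]
    gcongr
    have h4 : ‖(1 - (r : ℂ)) ^ (-d)‖ = (1 - r) ^ (-d.re) := by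
      have := Complex.norm_cpow_eq_rpow_re_of_pos hr1 (-d)
      simpa using this
    have h5 := norm_sub_norm_le ((1 - (r : ℂ)) ^ (-d)) 1
    rw [h4, norm_one] at h5
    linarith
  refine ⟨fun M => ?_, hT⟩
  have hI : ∀ᶠ r : ℝ in nhdsWithin 1 (Set.Iio 1), r ∈ Set.Ioo (0 : ℝ) 1 :=
    Ioo_mem_nhdsLT (by norm_num)
  obtain ⟨r, hr, hM⟩ := (hI.and (hT.eventually_gt_atTop M)).exists
  refine ⟨r, ?_, hM⟩
  rw [mem_ball_zero_iff, Complex.norm_real, Real.norm_eq_abs, abs_of_pos hr.1]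
  exact hr.2
end

section
/- Let λ ∈ (−π/2, π/2) with cos λ = 1/√2 (i.e., λ = ±π/4), and let f_λ(z) = ((1 − z)^{1 − 2 e^{iλ} cos λ} − 1)/(2 e^{iλ} cos λ − 1) on the unit disk 𝔻 (principal branch). Then f_λ is bounded on 𝔻: there exists M > 0 with |f_λ(z)| ≤ M for all z ∈ 𝔻. -/
open Metric

/-- If `cos λ = 1/√2` (i.e. λ = ±π/4), the extremal function
`f_λ(z) = ((1 − z)^{1 − 2e^{iλ}cos λ} − 1)/(2e^{iλ}cos λ − 1)` is bounded on 𝔻. -/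
theorem extremal_bounded_boundary_case (lam : ℝ)
    (hlam : lam ∈ Set.Ioo (-(Real.pi / 2)) (Real.pi / 2))
    (hcos : Real.cos lam = 1 / Real.sqrt 2)
    (flam : ℂ → ℂ)
    (hdef : ∀ z : ℂ, flam z =
      ((1 - z) ^ ((1 : ℂ) - 2 * Complex.exp ((lam : ℂ) * Complex.I) * ((Real.cos lam : ℝ) : ℂ)) - 1) /
        (2 * Complex.exp ((lam : ℂ) * Complex.I) * ((Real.cos lam : ℝ) : ℂ) - 1)) :
    ∃ M > 0, ∀ z ∈ ball (0 : ℂ) 1, ‖flam z‖ ≤ M := by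
  have hre : ((1 : ℂ) - 2 * Complex.exp ((lam : ℂ) * Complex.I) *
      ((Real.cos lam : ℝ) : ℂ)).re = 0 := by
    have h2 : Real.cos lam * Real.cos lam = 1 / 2 := by
      rw [hcos, div_mul_div_comm, Real.mul_self_sqrt (by norm_num)]
      norm_num
    have h3 : (Complex.exp ((lam : ℂ) * Complex.I)).re = Real.cos lam :=
      Complex.exp_ofReal_mul_I_re lam
    rw [Complex.sub_re, Complex.re_mul_ofReal, two_mul, Complex.add_re, h3, Complex.one_re]
    linarith
  generalize (2 * Complex.exp ((lam : ℂ) * Complex.I) * ((Real.cos lam : ℝ) : ℂ)) = c at *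
  refine ⟨(Real.exp (Real.pi * |(1 - c).im|) + 1) / ‖c - 1‖ + 1, by positivity, fun z _ => ?_⟩
  have hb : ‖(1 - z) ^ (1 - c)‖ ≤ Real.exp (Real.pi * |(1 - c).im|) := by
    refine (Complex.norm_cpow_le _ _).trans ?_
    rw [hre, Real.rpow_zero, one_div, ← Real.exp_neg]
    apply Real.exp_le_exp.mpr
    refine (neg_le_abs _).trans ?_
    rw [abs_mul]
    exact mul_le_mul_of_nonneg_right (Complex.abs_arg_le_pi _) (abs_nonneg _)
  rw [hdef, norm_div]
  have hn : ‖(1 - z) ^ (1 - c) - 1‖ ≤ Real.exp (Real.pi * |(1 - c).im|) + 1 := by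
    refine (norm_sub_le _ _).trans ?_
    rw [norm_one]
    linarith
  have := div_le_div_of_nonneg_right hn (norm_nonneg (c - 1))
  linarith
end
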